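/- Let 0 < ν < 1/2, and let f be locally integrable on (0,∞) with f(x) = O(x^{−a}) as x → 0⁺ and f(x) = O(x^{−b}) as x → ∞, where a < ν and 5/4 < b < 3/2, and with Mellin transform satisfying f*(1) = 0 and (f*)′(1) = 0. Define φ(x) = (1/(2π))·∫_ℝ Γ(1−s)·Γ(3/2−s)·Γ(s)·f*(s)/Γ(s−1/2) · x^{−s} dt, where s = ν + it. Then for every τ ≥ 0, (F f)(τ) = (1/(4·cosh(πτ)))·∫_0^∞ K_{iτ}(x)·[I_{iτ}(x) + I_{−iτ}(x)]·φ(x²)·x dx. -/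

import Mathlib

open MeasureTheory Set Filter Asymptotics

/-- Modified Bessel function of the second kind (integral representation, for Re z > 0). -/
noncomputable def besselK (nu z : ℂ) : ℂ :=
  ∫ t in Set.Ioi (0:ℝ), Complex.exp (-z * (Real.cosh t : ℂ)) * Complex.cosh (nu * (t : ℂ))

/-- The kernel 𝒦(x,τ) = ker²_{2iτ}(2(4x)^{1/4}) + kei²_{2iτ}(2(4x)^{1/4})
    = K_{2iτ}(2(4x)^{1/4}e^{iπ/4}) · K_{2iτ}(2(4x)^{1/4}e^{-iπ/4}), which is real. -/
noncomputable def kernelK (x τ : ℝ) : ℝ :=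
  (besselK (2 * Complex.I * (τ:ℂ))
      (((2 * (4*x) ^ ((1:ℝ)/4) : ℝ) : ℂ) * Complex.exp (Complex.I * (Real.pi:ℂ) / 4)) *
   besselK (2 * Complex.I * (τ:ℂ))
      (((2 * (4*x) ^ ((1:ℝ)/4) : ℝ) : ℂ) * Complex.exp (-(Complex.I * (Real.pi:ℂ)) / 4))).re

/-- K₀(y) = ∫₀^∞ exp(−y·cosh t) dt. -/
noncomputable def besselK0 (y : ℝ) : ℝ := ∫ t in Set.Ioi (0:ℝ), Real.exp (-y * Real.cosh t)

/-- K_{iτ}(x) = ∫₀^∞ exp(−x·cosh t)·cos(τt) dt (real-valued, purely imaginary order). -/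
noncomputable def besselKi (τ x : ℝ) : ℝ :=
  ∫ t in Set.Ioi (0:ℝ), Real.exp (-x * Real.cosh t) * Real.cos (τ * t)

/-- Modified Bessel function of the first kind I_ν(z) (power series). -/
noncomputable def besselI (nu z : ℂ) : ℂ :=
  ∑' n : ℕ, (z/2) ^ (nu + 2*(n:ℂ)) / ((n.factorial : ℂ) * Complex.Gamma (nu + (n:ℂ) + 1))

/-- B_ν(w) = ber²_ν(w) + bei²_ν(w) = I_ν(w·e^{iπ/4})·I_ν(w·e^{−iπ/4}). -/
noncomputable def kelvinB (nu w : ℂ) : ℂ :=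
  besselI nu (w * Complex.exp (Complex.I * (Real.pi:ℂ) / 4)) *
  besselI nu (w * Complex.exp (-(Complex.I * (Real.pi:ℂ)) / 4))

/-- Index transform (1.1): (F f)(τ) = ∫₀^∞ 𝒦(x,τ) f(x) dx. -/
noncomputable def indexF (f : ℝ → ℝ) (τ : ℝ) : ℝ := ∫ x in Set.Ioi (0:ℝ), kernelK x τ * f x

/-- Index transform (1.2): (G g)(x) = ∫₀^∞ 𝒦(x,τ) g(τ) dτ. -/
noncomputable def indexG (g : ℝ → ℝ) (x : ℝ) : ℝ := ∫ τ in Set.Ioi (0:ℝ), kernelK x τ * g τ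

/-- Index transform (1.2) for complex-valued densities. -/
noncomputable def indexGC (g : ℝ → ℂ) (x : ℝ) : ℂ :=
  ∫ τ in Set.Ioi (0:ℝ), (kernelK x τ : ℂ) * g τ

/-- Mellin transform of a real function. -/
noncomputable def mellinT (f : ℝ → ℝ) (s : ℂ) : ℂ :=
  ∫ x in Set.Ioi (0:ℝ), (f x : ℂ) * (x:ℂ) ^ (s - 1)

/-- Mellin transform of a complex function. -/
noncomputable def mellinC (F : ℝ → ℂ) (s : ℂ) : ℂ :=
  ∫ x in Set.Ioi (0:ℝ), F x * (x:ℂ) ^ (s - 1)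

/-- The L_{ν,p}(ℝ₊) norm. -/
noncomputable def Lnorm (ν p : ℝ) (f : ℝ → ℝ) : ℝ :=
  (∫ x in Set.Ioi (0:ℝ), |f x| ^ p * x ^ (ν*p - 1)) ^ (1/p)

/-- Euler beta function B(a,b) = Γ(a)Γ(b)/Γ(a+b). -/
noncomputable def betaFn (a b : ℝ) : ℝ := Real.Gamma a * Real.Gamma b / Real.Gamma (a+b)

/-- The auxiliary function φ of (2.6), as a line integral over Re s = ν. -/
noncomputable def phiFn (f : ℝ → ℝ) (ν x : ℝ) : ℂ :=
  (1/(2*(Real.pi:ℂ))) * ∫ t : ℝ,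
    Complex.Gamma (1 - ((ν:ℂ) + (t:ℂ)*Complex.I)) * Complex.Gamma (3/2 - ((ν:ℂ) + (t:ℂ)*Complex.I))
      * Complex.Gamma ((ν:ℂ) + (t:ℂ)*Complex.I) * mellinT f ((ν:ℂ) + (t:ℂ)*Complex.I)
      / Complex.Gamma (((ν:ℂ) + (t:ℂ)*Complex.I) - 1/2)
      * (x:ℂ) ^ (-((ν:ℂ) + (t:ℂ)*Complex.I))

lemma Complex.norm_Gamma_le_Gamma_re {z : ℂ} (hz : 0 < z.re) : ‖Complex.Gamma z‖ ≤ Real.Gamma z.re := by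
  rw [Complex.Gamma_eq_integral hz, Real.Gamma_eq_integral hz, Complex.GammaIntegral]
  refine (norm_integral_le_integral_norm _).trans (le_of_eq ?_)
  refine setIntegral_congr_fun measurableSet_Ioi fun x hx => ?_
  have hx' : (0:ℝ) < x := hx
  simp only [norm_mul, Complex.norm_real, Real.norm_eq_abs, abs_of_pos (Real.exp_pos _)]
  rw [Complex.norm_cpow_eq_rpow_re_of_pos hx']
  simp

lemma Complex.norm_Gamma_le_div_im {z : ℂ} (hz : 0 < z.re) (hi : z.im ≠ 0) :
    ‖Complex.Gamma z‖ ≤ Real.Gamma (z.re + 1) / |z.im| := by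
  have hz0 : z ≠ 0 := fun h => hz.ne' (by simp [h])
  have h := Complex.norm_Gamma_le_Gamma_re (z := z + 1) (by simp; linarith)
  rw [Complex.Gamma_add_one z hz0, norm_mul] at h
  rw [le_div_iff₀ (abs_pos.mpr hi)]
  simp only [Complex.add_re, Complex.one_re] at h
  calc _ ≤ ‖Complex.Gamma z‖ * ‖z‖ := by gcongr; exact Complex.abs_im_le_norm z
    _ ≤ _ := by rw [mul_comm]; exact h

lemma Complex.norm_Gamma_le_div_im_sq {z : ℂ} (hz : 0 < z.re) (hi : z.im ≠ 0) :
    ‖Complex.Gamma z‖ ≤ Real.Gamma (z.re + 2) / z.im ^ 2 := by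
  have hz0 : z ≠ 0 := fun h => hz.ne' (by simp [h])
  have h := Complex.norm_Gamma_le_div_im (z := z + 1) (by simp; linarith) (by simpa using hi)
  rw [Complex.Gamma_add_one z hz0, norm_mul] at h
  simp only [Complex.add_re, Complex.one_re, Complex.add_im, Complex.one_im, add_zero] at h
  rw [add_assoc, one_add_one_eq_two] at h
  have h0 := abs_pos.mpr hi
  rw [← sq_abs, sq, ← div_div, le_div_iff₀ h0]
  calc _ ≤ ‖Complex.Gamma z‖ * ‖z‖ := by gcongr; exact Complex.abs_im_le_norm z
    _ ≤ _ := by rw [mul_comm]; exact h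

lemma Complex.continuous_Gamma_comp {α : Type*} [TopologicalSpace α] {g : α → ℂ}
    (hg : Continuous g) (h : ∀ x, 0 < (g x).re) : Continuous fun x => Complex.Gamma (g x) := by
  refine continuous_iff_continuousAt.mpr fun x => ?_
  refine ContinuousAt.comp (f := g) (g := Complex.Gamma) ?_ hg.continuousAt
  refine (Complex.differentiableAt_Gamma _ fun m hm => ?_).continuousAt
  have := h x
  rw [hm] at this
  simp at this
  linarith [(Nat.cast_nonneg m : (0:ℝ) ≤ m)]

/-- A continuous function on the line with quadratic decay is integrable. -/
lemma integrable_of_norm_le_div_sq {F : ℝ → ℂ} (hF : Continuous F) {C : ℝ}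
    (h : ∀ t : ℝ, 1 ≤ |t| → ‖F t‖ ≤ C / t ^ 2) : Integrable F := by
  obtain ⟨D, hD⟩ := (isCompact_Icc (a := (-1:ℝ)) (b := 1)).exists_bound_of_continuousOn
    hF.continuousOn
  have hC : 0 ≤ C := by
    have := (norm_nonneg _).trans (h 1 (by simp))
    simpa using this
  have hD0 : 0 ≤ D := (norm_nonneg _).trans (hD 0 (by simp))
  refine (integrable_inv_one_add_sq.const_mul (2 * (C + D))).mono' hF.aestronglyMeasurable
    (Eventually.of_forall fun t => ?_)
  rw [← div_eq_mul_inv, le_div_iff₀ (by positivity)]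
  rcases le_total 1 |t| with ht | ht
  · have h2 : 1 ≤ t ^ 2 := by rw [← sq_abs]; nlinarith
    have h1 := h t ht
    rw [le_div_iff₀ (by positivity)] at h1
    nlinarith [norm_nonneg (F t)]
  · have h2 : t ^ 2 ≤ 1 := by rw [← sq_abs]; nlinarith [abs_nonneg t]
    have h1 := hD t (abs_le.mp ht)
    nlinarith [norm_nonneg (F t)]

lemma integrable_Gamma_vertical {σ : ℝ} (hσ : 0 < σ) (c : ℝ) (hc : c ≠ 0) :
    Integrable fun t : ℝ => Complex.Gamma (σ + (c * t : ℝ) * Complex.I) := by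
  refine integrable_of_norm_le_div_sq (C := Real.Gamma (σ + 2) / c ^ 2) ?_ fun t ht => ?_
  · exact Complex.continuous_Gamma_comp (by fun_prop) (fun t => by simpa using hσ)
  · have ht0 : t ≠ 0 := by rintro rfl; simp at ht; linarith
    have := Complex.norm_Gamma_le_div_im_sq (z := σ + (c * t : ℝ) * Complex.I) (by simpa using hσ)
      (by simp [hc, ht0])
    refine this.trans (le_of_eq ?_)
    simp [mul_pow, div_div]

/-- Mellin–Barnes representation of the exponential. -/
lemma exp_neg_eq_mellinBarnes {σ : ℝ} (hσ : 0 < σ) {x : ℝ} (hx : 0 < x) :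
    Complex.exp (-(x:ℂ)) = (1 / (2 * (Real.pi:ℂ))) *
      ∫ t : ℝ, (x:ℂ) ^ (-((σ:ℂ) + t * Complex.I)) * Complex.Gamma (σ + t * Complex.I) := by
  have hG : ∀ s : ℂ, 0 < s.re → mellin (fun x : ℝ => Complex.exp (-(x:ℂ))) s = Complex.Gamma s := by
    intro s hs
    rw [Complex.Gamma_eq_integral hs, Complex.GammaIntegral_eq_mellin]
    simp
  have h := mellinInv_mellin_eq σ (fun x : ℝ => Complex.exp (-(x:ℂ))) hx ?_ ?_ ?_
  · rw [← h, mellinInv]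
    have : (((1 / (2 * Real.pi) : ℝ)) : ℂ) = 1 / (2 * (Real.pi:ℂ)) := by push_cast; rfl
    rw [Complex.real_smul, this]
    congr 1
    refine integral_congr_ae (Eventually.of_forall fun t => ?_)
    simp only [smul_eq_mul]
    rw [hG]
    simpa using hσ
  · have := Complex.GammaIntegral_convergent (s := (σ:ℂ)) (by simpa using hσ)
    rw [MellinConvergent]
    refine this.congr_fun (fun x _ => ?_) measurableSet_Ioi
    simp [mul_comm]
  · rw [Complex.VerticalIntegrable]
    refine (integrable_Gamma_vertical hσ 1 one_ne_zero).congr (Eventually.of_forall fun t => ?_)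
    simp only [one_mul]
    rw [hG]
    simpa using hσ
  · fun_prop

lemma sigmoid_two_mul (u : ℝ) : Real.sigmoid (2 * u) = Real.exp u / (2 * Real.cosh u) := by
  have h := Real.exp_pos u
  rw [Real.sigmoid_def, Real.cosh_eq, show -(2*u) = -u + -u by ring, Real.exp_add, Real.exp_neg]
  field_simp

lemma one_sub_sigmoid_two_mul (u : ℝ) :
    1 - Real.sigmoid (2 * u) = Real.exp (-u) / (2 * Real.cosh u) := by
  rw [← Real.sigmoid_neg, ← mul_neg, sigmoid_two_mul, Real.cosh_neg]

lemma ofReal_exp_div_cpow (u : ℝ) {C : ℝ} (hC : 0 < C) (α : ℂ) :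
    ((Real.exp u / C : ℝ) : ℂ) ^ α = Complex.exp (α * u) * (C:ℂ) ^ (-α) := by
  have h : 0 < Real.exp u / C := by positivity
  rw [Complex.cpow_def_of_ne_zero (by exact_mod_cast h.ne'), Complex.cpow_def_of_ne_zero
    (by exact_mod_cast hC.ne'), ← Complex.ofReal_log h.le, ← Complex.ofReal_log hC.le,
    Real.log_div (Real.exp_ne_zero _) hC.ne', Real.log_exp, ← Complex.exp_add]
  push_cast
  congr 1
  ring

lemma beta_integrand_comp_sigmoid (α β : ℂ) (u : ℝ) :
    |2 * (Real.sigmoid (2 * u) * (1 - Real.sigmoid (2 * u)))| •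
      (((Real.sigmoid (2 * u) : ℝ) : ℂ) ^ (α - 1) *
        (1 - ((Real.sigmoid (2 * u) : ℝ) : ℂ)) ^ (β - 1)) =
    2 * (2:ℂ) ^ (-(α + β)) *
      (Complex.exp ((α - β) * u) * ((Real.cosh u : ℝ) : ℂ) ^ (-(α + β))) := by
  have hC : 0 < 2 * Real.cosh u := by have := Real.cosh_pos u; positivity
  have h1 := Real.sigmoid_pos (2 * u)
  have h2 : 0 < 1 - Real.sigmoid (2 * u) := by linarith [Real.sigmoid_lt_one (2 * u)]
  rw [abs_of_pos (by positivity), Complex.real_smul]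
  have e1 : ((Real.sigmoid (2 * u) : ℝ) : ℂ) ^ (α - 1) =
      ((Real.sigmoid (2 * u) : ℝ) : ℂ) ^ α / ((Real.sigmoid (2 * u) : ℝ) : ℂ) := by
    rw [Complex.cpow_sub _ _ (by exact_mod_cast h1.ne'), Complex.cpow_one]
  have e2 : (1 - ((Real.sigmoid (2 * u) : ℝ) : ℂ)) ^ (β - 1) =
      (1 - ((Real.sigmoid (2 * u) : ℝ) : ℂ)) ^ β / (1 - ((Real.sigmoid (2 * u) : ℝ) : ℂ)) := by
    rw [Complex.cpow_sub _ _ (by exact_mod_cast h2.ne'), Complex.cpow_one]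
  have n1 : ((Real.sigmoid (2 * u) : ℝ) : ℂ) ≠ 0 := by exact_mod_cast h1.ne'
  have n2 : (1 - ((Real.sigmoid (2 * u) : ℝ) : ℂ)) ≠ 0 := by exact_mod_cast h2.ne'
  have e3 : (1 - ((Real.sigmoid (2 * u) : ℝ) : ℂ)) ^ β =
      ((Real.exp (-u) / (2 * Real.cosh u) : ℝ) : ℂ) ^ β := by
    rw [← one_sub_sigmoid_two_mul]; push_cast; rfl
  have e4 : (2:ℂ) ^ (-(α + β)) * ((Real.cosh u : ℝ) : ℂ) ^ (-(α + β)) =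
      (((2 * Real.cosh u : ℝ)) : ℂ) ^ (-(α + β)) := by
    rw [Complex.ofReal_mul, Complex.mul_cpow_ofReal_nonneg (by norm_num) (Real.cosh_pos u).le]
    simp
  have n3 : (((2 * Real.cosh u : ℝ)) : ℂ) ≠ 0 := by exact_mod_cast hC.ne'
  calc _ = 2 * (((Real.sigmoid (2 * u) : ℝ) : ℂ) ^ α *
          (1 - ((Real.sigmoid (2 * u) : ℝ) : ℂ)) ^ β) := by
        rw [e1, e2]; push_cast; field_simp
    _ = 2 * ((Complex.exp (α * u) * Complex.exp (β * (-u : ℝ))) *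
          ((((2 * Real.cosh u : ℝ)) : ℂ) ^ (-α) * (((2 * Real.cosh u : ℝ)) : ℂ) ^ (-β))) := by
        rw [e3, sigmoid_two_mul, ofReal_exp_div_cpow _ hC, ofReal_exp_div_cpow _ hC]; ring
    _ = _ := by
        rw [← Complex.exp_add, ← Complex.cpow_add _ _ n3, ← neg_add, ← e4]
        rw [show α * u + β * (-u : ℝ) = (α - β) * u by push_cast; ring]
        ring

lemma image_sigmoid_two_mul : (fun u : ℝ => Real.sigmoid (2 * u)) '' univ = Ioo 0 1 := by
  rw [image_univ, ← Real.range_sigmoid]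
  exact (mul_left_surjective₀ (two_ne_zero' ℝ)).range_comp Real.sigmoid

lemma hasDerivAt_sigmoid_two_mul (u : ℝ) : HasDerivAt (fun u : ℝ => Real.sigmoid (2 * u))
    (2 * (Real.sigmoid (2 * u) * (1 - Real.sigmoid (2 * u)))) u := by
  have := (Real.hasDerivAt_sigmoid (2 * u)).comp u ((hasDerivAt_id u).const_mul 2)
  simpa [Function.comp_def, mul_comm] using this

lemma injOn_sigmoid_two_mul : InjOn (fun u : ℝ => Real.sigmoid (2 * u)) univ := by
  intro u _ v _ h
  have := Real.sigmoid_injective h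
  linarith

lemma integrable_exp_mul_cosh_cpow {α β : ℂ} (hα : 0 < α.re) (hβ : 0 < β.re) :
    Integrable fun u : ℝ =>
      Complex.exp ((α - β) * u) * ((Real.cosh u : ℝ) : ℂ) ^ (-(α + β)) := by
  have h := Complex.betaIntegral_convergent hα hβ
  rw [intervalIntegrable_iff_integrableOn_Ioo_of_le zero_le_one, ← image_sigmoid_two_mul,
    integrableOn_image_iff_integrableOn_abs_deriv_smul MeasurableSet.univ
      (fun u _ => (hasDerivAt_sigmoid_two_mul u).hasDerivWithinAt) injOn_sigmoid_two_mul] at h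
  simp only [beta_integrand_comp_sigmoid, integrableOn_univ] at h
  have h2 : 2 * (2:ℂ) ^ (-(α + β)) ≠ 0 := by simp [Complex.cpow_eq_zero_iff]
  simpa [← mul_assoc, h2, inv_mul_cancel₀ h2] using h.const_mul (2 * (2:ℂ) ^ (-(α + β)))⁻¹

lemma integral_exp_mul_cosh_cpow {α β : ℂ} (hα : 0 < α.re) (hβ : 0 < β.re) :
    ∫ u : ℝ, Complex.exp ((α - β) * u) * ((Real.cosh u : ℝ) : ℂ) ^ (-(α + β)) =
      (2:ℂ) ^ (α + β - 1) * (Complex.Gamma α * Complex.Gamma β / Complex.Gamma (α + β)) := by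
  have h := Complex.betaIntegral_eq_Gamma_mul_div α β hα hβ
  rw [Complex.betaIntegral, intervalIntegral.integral_of_le zero_le_one,
    integral_Ioc_eq_integral_Ioo, ← image_sigmoid_two_mul,
    integral_image_eq_integral_abs_deriv_smul MeasurableSet.univ
      (fun u _ => (hasDerivAt_sigmoid_two_mul u).hasDerivWithinAt) injOn_sigmoid_two_mul] at h
  simp only [beta_integrand_comp_sigmoid, Measure.restrict_univ] at h
  rw [integral_const_mul] at h
  have h2 : (2:ℂ) ^ (α + β - 1) * (2 * 2 ^ (-(α + β))) = 1 := by
    rw [Complex.cpow_sub _ _ two_ne_zero, Complex.cpow_one, Complex.cpow_neg]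
    have : (2:ℂ) ^ (α + β) ≠ 0 := by simp [Complex.cpow_eq_zero_iff]
    field_simp
  rw [← h, ← mul_assoc, h2, one_mul]

/-- The cosine transform of a power of the hyperbolic cosine. -/
noncomputable def coshTransform (τ : ℝ) (w : ℂ) : ℂ :=
  ∫ u : ℝ, Complex.exp (2 * Complex.I * τ * u) * ((Real.cosh u : ℝ) : ℂ) ^ (-(2 * w))

lemma coshTransform_eq (τ : ℝ) {w : ℂ} (hw : 0 < w.re) :
    coshTransform τ w = (2:ℂ) ^ (2 * w - 1) *
      (Complex.Gamma (w + Complex.I * τ) * Complex.Gamma (w - Complex.I * τ) /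
        Complex.Gamma (2 * w)) := by
  have := integral_exp_mul_cosh_cpow (α := w + Complex.I * τ) (β := w - Complex.I * τ)
    (by simpa using hw) (by simpa using hw)
  rw [show w + Complex.I * τ + (w - Complex.I * τ) = 2 * w by ring] at this
  rw [← this, coshTransform]
  congr 1 with u
  congr 2
  ring

lemma integrable_cosh_rpow {σ : ℝ} (hσ : 0 < σ) : Integrable fun u : ℝ => Real.cosh u ^ (-σ) := by
  have := (integrable_exp_mul_cosh_cpow (α := (σ / 2 : ℝ)) (β := (σ / 2 : ℝ))
    (by simpa using hσ) (by simpa using hσ)).norm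
  refine this.congr (Eventually.of_forall fun u => ?_)
  simp only [sub_self, zero_mul, Complex.exp_zero, one_mul]
  rw [Complex.norm_cpow_eq_rpow_re_of_pos (Real.cosh_pos u)]
  congr 1
  simp

lemma exp_neg_le_two_div_sq {y : ℝ} (hy : 0 < y) : Real.exp (-y) ≤ 2 / y ^ 2 := by
  have := Real.quadratic_le_exp_of_nonneg hy.le
  rw [Real.exp_neg, inv_le_comm₀ (Real.exp_pos _) (by positivity), inv_div]
  linarith

lemma integrable_cosh_mul_exp_neg_cosh {c : ℝ} (hc : 0 < c) :
    Integrable fun q : ℝ => Real.cosh q * Real.exp (-(c * Real.cosh q)) := by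
  refine ((integrable_cosh_rpow one_pos).const_mul (2 / c ^ 2)).mono' ?_
    (Eventually.of_forall fun q => ?_)
  · exact (by fun_prop : Continuous fun q : ℝ =>
      Real.cosh q * Real.exp (-(c * Real.cosh q))).aestronglyMeasurable
  · have h0 := Real.cosh_pos q
    rw [Real.norm_of_nonneg (by positivity), Real.rpow_neg_one]
    calc _ ≤ Real.cosh q * (2 / (c * Real.cosh q) ^ 2) := by
          gcongr; exact exp_neg_le_two_div_sq (by positivity)
      _ = _ := by field_simp

lemma integrable_exp_neg_cosh {c : ℝ} (hc : 0 < c) :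
    Integrable fun q : ℝ => Real.exp (-(c * Real.cosh q)) := by
  refine (integrable_cosh_mul_exp_neg_cosh hc).mono'
    (by fun_prop : Continuous fun q : ℝ => Real.exp (-(c * Real.cosh q))).aestronglyMeasurable
    (Eventually.of_forall fun q => ?_)
  rw [Real.norm_of_nonneg (by positivity)]
  exact le_mul_of_one_le_left (Real.exp_pos _).le (Real.one_le_cosh q)

lemma Complex.sinh_add_mul_I (x y : ℂ) : Complex.sinh (x + y * Complex.I) =
    Complex.sinh x * Complex.cos y + Complex.cosh x * Complex.sin y * Complex.I := by
  rw [Complex.sinh_add, Complex.sinh_mul_I, Complex.cosh_mul_I]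
  ring

lemma Complex.cosh_add_mul_I (x y : ℂ) : Complex.cosh (x + y * Complex.I) =
    Complex.cosh x * Complex.cos y + Complex.sinh x * Complex.sin y * Complex.I := by
  rw [Complex.cosh_add, Complex.sinh_mul_I, Complex.cosh_mul_I]
  ring

lemma norm_sinh_add_mul_I_le (q θ : ℝ) : ‖Complex.sinh (q + θ * Complex.I)‖ ≤ Real.cosh q := by
  rw [Complex.sinh_add_mul_I, ← Complex.ofReal_sinh, ← Complex.ofReal_cosh, ← Complex.ofReal_sin,
    ← Complex.ofReal_cos, ← Complex.ofReal_mul, ← Complex.ofReal_mul, Complex.norm_add_mul_I]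
  refine Real.sqrt_le_iff.mpr ⟨(Real.cosh_pos q).le, ?_⟩
  have h1 := Real.cosh_sq q
  have h2 := Real.sin_sq_add_cos_sq θ
  nlinarith [sq_nonneg (Real.sin θ), sq_nonneg (Real.cos θ)]

lemma norm_exp_neg_mul_cosh (R q θ : ℝ) :
    ‖Complex.exp (-(R * Complex.cosh (q + θ * Complex.I)))‖ =
      Real.exp (-(R * Real.cos θ * Real.cosh q)) := by
  rw [Complex.norm_exp, Complex.cosh_add_mul_I, ← Complex.ofReal_sinh, ← Complex.ofReal_cosh,
    ← Complex.ofReal_sin, ← Complex.ofReal_cos]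
  congr 1
  simp [-Complex.ofReal_cos]
  ring

lemma integral_exp_neg_mul_cosh_add_mul_I {R θ : ℝ} (hR : 0 < R)
    (hθ : θ ∈ Ioo (-(Real.pi / 2)) (Real.pi / 2)) :
    ∫ q : ℝ, Complex.exp (-(R * Complex.cosh (q + θ * Complex.I))) =
      ∫ q : ℝ, ((Real.exp (-(R * Real.cosh q)) : ℝ) : ℂ) := by
  set F : ℝ → ℝ → ℂ := fun θ q => Complex.exp (-(R * Complex.cosh (q + θ * Complex.I))) with hF
  set D : ℝ → ℝ → ℂ := fun θ q =>
    Complex.exp (-(R * Complex.cosh (q + θ * Complex.I))) *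
      (-(R * Complex.sinh (q + θ * Complex.I))) with hD
  have hFint : ∀ θ ∈ Ioo (-(Real.pi / 2)) (Real.pi / 2), Integrable (F θ) := by
    intro θ hθ
    have hc := Real.cos_pos_of_mem_Ioo hθ
    refine (integrable_exp_neg_cosh (mul_pos hR hc)).mono'
      (by simp only [hF]; fun_prop : Continuous (F θ)).aestronglyMeasurable
      (Eventually.of_forall fun q => (norm_exp_neg_mul_cosh R q θ).le)
  have hderiv : ∀ θ ∈ Ioo (-(Real.pi / 2)) (Real.pi / 2),
      HasDerivAt (fun θ => ∫ q, F θ q) 0 θ := by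
    intro θ hθ
    have hc := Real.cos_pos_of_mem_Ioo hθ
    have hs : {θ' : ℝ | Real.cos θ / 2 < Real.cos θ'} ∈ nhds θ :=
      Real.continuous_cos.continuousAt.eventually (lt_mem_nhds (by linarith))
    have key := hasDerivAt_integral_of_dominated_loc_of_deriv_le (F := F)
      (F' := fun θ q => D θ q * Complex.I) (μ := volume) (x₀ := θ)
      (bound := fun q => R * (Real.cosh q * Real.exp (-(R * (Real.cos θ / 2) * Real.cosh q))))
      hs (Eventually.of_forall fun θ' =>
        (by simp only [hF]; fun_prop : Continuous (F θ')).aestronglyMeasurable)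
      (hFint θ hθ)
      (by simp only [hD]; fun_prop :
        Continuous fun q => D θ q * Complex.I).aestronglyMeasurable
      (Eventually.of_forall fun q θ' hθ' => ?_)
      ((integrable_cosh_mul_exp_neg_cosh (by positivity)).const_mul R)
      (Eventually.of_forall fun q θ' _ => ?_)
    · have hint : Integrable (D θ) := by
        have := key.1.mul_const (-Complex.I)
        simpa [mul_assoc] using this
      have h0 : ∫ q, D θ q = 0 := by
        refine integral_eq_zero_of_hasDerivAt_of_integrable (f := F θ) (fun q => ?_) hint
          (hFint θ hθ)
        have h1 : HasDerivAt (fun z : ℂ => Complex.exp (-(R * Complex.cosh (z + θ * Complex.I))))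
            (D θ q) (q:ℂ) := by
          have := (((((hasDerivAt_id (q:ℂ)).add_const (θ * Complex.I)).ccosh).const_mul
            (R:ℂ)).neg).cexp
          simpa [hD] using this
        exact h1.comp_ofReal
      have := key.2
      rwa [integral_mul_const, h0, zero_mul] at this
    · simp only [hD, norm_mul, Complex.norm_I, mul_one, norm_neg]
      rw [norm_exp_neg_mul_cosh, Complex.norm_real, Real.norm_of_nonneg hR.le]
      have h3 := norm_sinh_add_mul_I_le q θ'
      have h4 : Real.exp (-(R * Real.cos θ' * Real.cosh q)) ≤
          Real.exp (-(R * (Real.cos θ / 2) * Real.cosh q)) := by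
        have := Real.cosh_pos q
        have : Real.cos θ / 2 < Real.cos θ' := hθ'
        gcongr
      calc _ ≤ Real.exp (-(R * (Real.cos θ / 2) * Real.cosh q)) * (R * Real.cosh q) := by gcongr
        _ = _ := by ring
    · have h1 : HasDerivAt (fun z : ℂ => Complex.exp (-(R * Complex.cosh (q + z * Complex.I))))
          (D θ' q * Complex.I) (θ':ℂ) := by
        have := ((((((hasDerivAt_id (θ':ℂ)).mul_const Complex.I).const_add (q:ℂ)).ccosh).const_mul
          (R:ℂ)).neg).cexp
        refine this.congr_deriv ?_
        simp only [hD, id, Pi.neg_apply]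
        ring
      exact h1.comp_ofReal
  have h0 : (0:ℝ) ∈ Ioo (-(Real.pi / 2)) (Real.pi / 2) :=
    ⟨by linarith [Real.pi_pos], by linarith [Real.pi_pos]⟩
  have := isOpen_Ioo.is_const_of_deriv_eq_zero isPreconnected_Ioo
    (fun θ hθ => (hderiv θ hθ).differentiableAt.differentiableWithinAt)
    (fun θ hθ => (hderiv θ hθ).deriv) hθ h0
  refine this.trans (integral_congr_ae (Eventually.of_forall fun q => ?_))
  simp [hF]

lemma integral_exp_neg_cosh_add_sinh {X : ℝ} (hX : 0 < X) (Y : ℝ) :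
    ∫ q : ℝ, Complex.exp (-(X * Complex.cosh q + Y * Complex.I * Complex.sinh q)) =
      ∫ q : ℝ, ((Real.exp (-(Real.sqrt (X ^ 2 + Y ^ 2) * Real.cosh q)) : ℝ) : ℂ) := by
  have hR : 0 < Real.sqrt (X ^ 2 + Y ^ 2) := Real.sqrt_pos.mpr (by positivity)
  rw [← integral_exp_neg_mul_cosh_add_mul_I hR (θ := Real.arctan (Y / X))
    ⟨Real.neg_pi_div_two_lt_arctan _, Real.arctan_lt_pi_div_two _⟩]
  have hS : Real.sqrt (1 + (Y / X) ^ 2) = Real.sqrt (X ^ 2 + Y ^ 2) / X := by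
    rw [show 1 + (Y / X) ^ 2 = (X ^ 2 + Y ^ 2) / X ^ 2 by field_simp,
      Real.sqrt_div' _ (by positivity), Real.sqrt_sq hX.le]
  refine integral_congr_ae (Eventually.of_forall fun q => ?_)
  simp only
  rw [Complex.cosh_add_mul_I, ← Complex.ofReal_cos, ← Complex.ofReal_sin, Real.cos_arctan,
    Real.sin_arctan, hS]
  have hR' : ((Real.sqrt (X ^ 2 + Y ^ 2) : ℝ) : ℂ) ≠ 0 := by exact_mod_cast hR.ne'
  have hX' : (X : ℂ) ≠ 0 := by exact_mod_cast hX.ne'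
  congr 2
  push_cast
  field_simp

lemma norm_exp_neg_mul_cosh_mul_exp (z : ℂ) (τ u : ℝ) :
    ‖Complex.exp (-z * (Real.cosh u : ℂ)) * Complex.exp (2 * Complex.I * τ * u)‖ =
      Real.exp (-(z.re * Real.cosh u)) := by
  rw [norm_mul, Complex.norm_exp, Complex.norm_exp, ← Real.exp_add]
  congr 1
  simp [-Complex.ofReal_cosh]

lemma integrable_exp_neg_mul_cosh_mul_exp {z : ℂ} (hz : 0 < z.re) (τ : ℝ) :
    Integrable fun u : ℝ =>
      Complex.exp (-z * (Real.cosh u : ℂ)) * Complex.exp (2 * Complex.I * τ * u) := by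
  refine (integrable_exp_neg_cosh hz).mono' (by fun_prop : Continuous fun u : ℝ =>
      Complex.exp (-z * (Real.cosh u : ℂ)) *
        Complex.exp (2 * Complex.I * τ * u)).aestronglyMeasurable
    (Eventually.of_forall fun u => (norm_exp_neg_mul_cosh_mul_exp z τ u).le)

lemma besselK_eq_integral_univ {z : ℂ} (hz : 0 < z.re) (τ : ℝ) :
    besselK (2 * Complex.I * τ) z = (1 / 2) * ∫ u : ℝ,
      Complex.exp (-z * (Real.cosh u : ℂ)) * Complex.exp (2 * Complex.I * τ * u) := by
  have hi := integrable_exp_neg_mul_cosh_mul_exp hz τ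
  have hi' := integrable_exp_neg_mul_cosh_mul_exp hz (-τ)
  rw [← intervalIntegral.integral_Iic_add_Ioi (b := (0:ℝ)) hi.integrableOn hi.integrableOn]
  have h1 : ∫ u : ℝ in Iic 0,
      Complex.exp (-z * (Real.cosh u : ℂ)) * Complex.exp (2 * Complex.I * τ * u) =
      ∫ u : ℝ in Ioi 0,
        Complex.exp (-z * (Real.cosh u : ℂ)) * Complex.exp (2 * Complex.I * (-τ : ℝ) * u) := by
    have := integral_comp_neg_Ioi (0:ℝ) (fun u : ℝ =>
      Complex.exp (-z * (Real.cosh u : ℂ)) * Complex.exp (2 * Complex.I * τ * u))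
    rw [neg_zero] at this
    rw [← this]
    simp
  rw [h1, ← integral_add hi'.integrableOn hi.integrableOn, ← integral_const_mul, besselK]
  refine setIntegral_congr_fun measurableSet_Ioi fun u _ => ?_
  simp only [Complex.cosh]
  push_cast
  ring_nf

lemma besselK_mul_besselK {z z' : ℂ} (hz : 0 < z.re) (hz' : 0 < z'.re) (τ : ℝ) :
    besselK (2 * Complex.I * τ) z * besselK (2 * Complex.I * τ) z' =
      (1 / 4) * ∫ s : ℝ, Complex.exp (2 * Complex.I * τ * s) *
        ∫ u : ℝ, Complex.exp (-(z * Complex.cosh u + z' * Complex.cosh (s - u))) := by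
  have h := integral_convolution (μ := volume) (ν := volume) (ContinuousLinearMap.mul ℝ ℂ)
    (integrable_exp_neg_mul_cosh_mul_exp hz τ) (integrable_exp_neg_mul_cosh_mul_exp hz' τ)
  rw [besselK_eq_integral_univ hz, besselK_eq_integral_univ hz']
  simp only [ContinuousLinearMap.mul_apply'] at h
  rw [mul_mul_mul_comm, ← h, show (1/2 : ℂ) * (1/2) = 1/4 by norm_num]
  congr 1
  refine integral_congr_ae (Eventually.of_forall fun s => ?_)
  simp only [MeasureTheory.convolution_def, ContinuousLinearMap.mul_apply']
  rw [← integral_const_mul]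
  refine integral_congr_ae (Eventually.of_forall fun u => ?_)
  simp only [← Complex.exp_add]
  congr 1
  push_cast
  ring

lemma integral_exp_neg_cosh_add_cosh {r : ℝ} (hr : 0 < r) (s : ℝ) :
    ∫ u : ℝ, Complex.exp (-((r * (1 + Complex.I)) * Complex.cosh u +
        (r * (1 - Complex.I)) * Complex.cosh (s - u))) =
      ∫ q : ℝ, ((Real.exp (-(2 * r * Real.sqrt (Real.cosh s) * Real.cosh q)) : ℝ) : ℂ) := by
  rw [← integral_add_right_eq_self _ (s / 2)]
  have hc := Real.cosh_pos (s / 2)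
  have h := integral_exp_neg_cosh_add_sinh (X := 2 * r * Real.cosh (s / 2)) (by positivity)
    (2 * r * Real.sinh (s / 2))
  have hs : Real.sqrt ((2 * r * Real.cosh (s / 2)) ^ 2 + (2 * r * Real.sinh (s / 2)) ^ 2) =
      2 * r * Real.sqrt (Real.cosh s) := by
    rw [mul_pow, mul_pow _ (Real.sinh _), ← mul_add, ← Real.cosh_two_mul,
      Real.sqrt_mul (by positivity), Real.sqrt_sq (by positivity)]
    congr 3
    ring
  rw [hs] at h
  rw [← h]
  refine integral_congr_ae (Eventually.of_forall fun q => ?_)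
  simp only
  congr 2
  have e1 : Complex.cosh ((q + s / 2 : ℝ) : ℂ) = Complex.cosh (s / 2) * Complex.cosh q +
      Complex.sinh (s / 2) * Complex.sinh q := by
    push_cast; rw [Complex.cosh_add]; ring
  have e2 : Complex.cosh (s - (q + s / 2 : ℝ)) = Complex.cosh (s / 2) * Complex.cosh q -
      Complex.sinh (s / 2) * Complex.sinh q := by
    rw [← Complex.cosh_sub]; congr 1; push_cast; ring
  rw [e1, e2]
  push_cast
  ring

lemma kernelK_eq {x : ℝ} (hx : 0 < x) (τ : ℝ) :
    (kernelK x τ : ℂ) = (1 / 4) * ∫ s : ℝ, Complex.exp (2 * Complex.I * τ * s) *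
      ∫ q : ℝ, ((Real.exp (-(4 * x ^ (1 / 4 : ℝ) * Real.sqrt (Real.cosh s) * Real.cosh q)) : ℝ) : ℂ)
      := by
  set r : ℝ := 2 * x ^ (1 / 4 : ℝ) with hr
  have hr0 : 0 < r := by positivity
  have h4 : (4 : ℝ) ^ (1 / 4 : ℝ) = Real.sqrt 2 := by
    rw [Real.sqrt_eq_rpow, show (4:ℝ) = 2 ^ (2:ℝ) by norm_num, ← Real.rpow_mul (by norm_num)]
    norm_num
  have hs2 : ((Real.sqrt 2 : ℝ) : ℂ) * ((Real.sqrt 2 : ℝ) : ℂ) = 2 := by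
    norm_cast; simp
  have hexp : Complex.exp (Complex.I * Real.pi / 4) =
      (Real.sqrt 2 : ℝ) / 2 * (1 + Complex.I) := by
    rw [show Complex.I * Real.pi / 4 = ((Real.pi / 4 : ℝ) : ℂ) * Complex.I by push_cast; ring,
      Complex.exp_mul_I, ← Complex.ofReal_cos, ← Complex.ofReal_sin, Real.cos_pi_div_four,
      Real.sin_pi_div_four]
    push_cast; ring
  have hexp' : Complex.exp (-(Complex.I * Real.pi) / 4) =
      (Real.sqrt 2 : ℝ) / 2 * (1 - Complex.I) := by
    rw [show -(Complex.I * Real.pi) / 4 = ((-(Real.pi / 4) : ℝ) : ℂ) * Complex.I by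
        push_cast; ring,
      Complex.exp_mul_I, ← Complex.ofReal_cos, ← Complex.ofReal_sin, Real.cos_neg, Real.sin_neg,
      Real.cos_pi_div_four, Real.sin_pi_div_four]
    push_cast; ring
  have hz : ((2 * (4 * x) ^ ((1:ℝ) / 4) : ℝ) : ℂ) * Complex.exp (Complex.I * Real.pi / 4) =
      r * (1 + Complex.I) := by
    rw [hexp, Real.mul_rpow (by norm_num) hx.le, h4, hr]
    push_cast
    linear_combination ((x ^ (1 / 4 : ℝ) : ℝ) : ℂ) * (1 + Complex.I) * hs2
  have hz' : ((2 * (4 * x) ^ ((1:ℝ) / 4) : ℝ) : ℂ) * Complex.exp (-(Complex.I * Real.pi) / 4) =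
      r * (1 - Complex.I) := by
    rw [hexp', Real.mul_rpow (by norm_num) hx.le, h4, hr]
    push_cast
    linear_combination ((x ^ (1 / 4 : ℝ) : ℝ) : ℂ) * (1 - Complex.I) * hs2
  have hconj : besselK (2 * Complex.I * τ) (r * (1 - Complex.I)) =
      (starRingEnd ℂ) (besselK (2 * Complex.I * τ) (r * (1 + Complex.I))) := by
    rw [besselK, besselK, ← integral_conj]
    refine integral_congr_ae (Eventually.of_forall fun u => ?_)
    simp only [map_mul, ← Complex.exp_conj, ← Complex.cosh_conj, map_neg, Complex.conj_ofReal,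
      map_add, map_one, Complex.conj_I, map_ofNat]
    rw [show 2 * -Complex.I * τ * u = -(2 * Complex.I * τ * u) by ring, Complex.cosh_neg]
    simp [sub_eq_add_neg]
  have hprod := besselK_mul_besselK (z := r * (1 + Complex.I)) (z' := r * (1 - Complex.I))
    (by simpa using hr0) (by simpa using hr0) τ
  rw [kernelK, hz, hz']
  have hre : (((besselK (2 * Complex.I * τ) (r * (1 + Complex.I)) *
      besselK (2 * Complex.I * τ) (r * (1 - Complex.I))).re : ℝ) : ℂ) =
      besselK (2 * Complex.I * τ) (r * (1 + Complex.I)) *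
      besselK (2 * Complex.I * τ) (r * (1 - Complex.I)) := by
    rw [hconj, Complex.mul_conj, Complex.ofReal_re]
  rw [hre, hprod]
  simp only [integral_exp_neg_cosh_add_cosh hr0]
  simp only [hr, ← mul_assoc]
  norm_num

lemma continuous_cosh_cpow {w : ℝ → ℂ} (hw : Continuous w) :
    Continuous fun p : ℝ × ℝ => ((Real.cosh p.1 : ℝ) : ℂ) ^ (-(2 * w p.2)) := by
  refine Continuous.cpow (by fun_prop) (by fun_prop) fun p => ?_
  exact Complex.ofReal_mem_slitPlane.mpr (Real.cosh_pos _)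

lemma integrable_coshTransform_prod {σ : ℝ} (hσ : 0 < σ) (τ : ℝ) {w h : ℝ → ℂ}
    (hw : Continuous w) (hre : ∀ t, (w t).re = σ) (hh : Integrable h) :
    Integrable (fun p : ℝ × ℝ => Complex.exp (2 * Complex.I * τ * p.1) *
      (((Real.cosh p.1 : ℝ) : ℂ) ^ (-(2 * w p.2)) * h p.2)) (volume.prod volume) := by
  refine ((integrable_cosh_rpow (σ := 2 * σ) (by positivity)).mul_prod hh.norm).mono' ?_
    (Eventually.of_forall fun p => ?_)
  · exact (by fun_prop : Continuous fun p : ℝ × ℝ =>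
      Complex.exp (2 * Complex.I * τ * p.1)).aestronglyMeasurable.mul
        ((continuous_cosh_cpow hw).aestronglyMeasurable.mul hh.1.comp_snd)
  · rw [norm_mul, norm_mul, Complex.norm_cpow_eq_rpow_re_of_pos (Real.cosh_pos _),
      show (2 * Complex.I * τ * p.1 : ℂ) = ((2 * τ * p.1 : ℝ) : ℂ) * Complex.I by push_cast; ring,
      Complex.norm_exp_ofReal_mul_I, one_mul]
    simp [hre]

lemma integral_coshTransform_mul {σ : ℝ} (hσ : 0 < σ) (τ : ℝ) {w h : ℝ → ℂ}
    (hw : Continuous w) (hre : ∀ t, (w t).re = σ) (hh : Integrable h) :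
    ∫ s : ℝ, Complex.exp (2 * Complex.I * τ * s) *
      ∫ t : ℝ, ((Real.cosh s : ℝ) : ℂ) ^ (-(2 * w t)) * h t =
      ∫ t : ℝ, coshTransform τ (w t) * h t := by
  simp only [← integral_const_mul]
  rw [integral_integral_swap (integrable_coshTransform_prod hσ τ hw hre hh)]
  simp only [← mul_assoc, integral_mul_const, coshTransform]

lemma integrable_coshTransform_mul {σ : ℝ} (hσ : 0 < σ) (τ : ℝ) {w h : ℝ → ℂ}
    (hw : Continuous w) (hre : ∀ t, (w t).re = σ) (hh : Integrable h) :
    Integrable fun t : ℝ => coshTransform τ (w t) * h t := by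
  have := (integrable_coshTransform_prod hσ τ hw hre hh).integral_prod_right
  simpa only [← mul_assoc, integral_mul_const, coshTransform] using this

/-- The parametrisation of the line `re w = 1 / 4` used in the Mellin–Barnes integrals. -/
noncomputable def quarterLine (t : ℝ) : ℂ := 1 / 4 - t * Complex.I

@[simp] lemma quarterLine_re (t : ℝ) : (quarterLine t).re = 1 / 4 := by simp [quarterLine]

lemma continuous_quarterLine : Continuous quarterLine := by unfold quarterLine; fun_prop

lemma four_mul_quarterLine (t : ℝ) :
    4 * quarterLine t = ((1:ℝ):ℂ) + (-4 * t : ℝ) * Complex.I := by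
  rw [quarterLine]; push_cast; ring

lemma integrable_Gamma_quarterLine :
    Integrable fun t : ℝ => Complex.Gamma (4 * quarterLine t) := by
  simpa only [four_mul_quarterLine] using integrable_Gamma_vertical one_pos (-4) (by norm_num)

lemma exp_neg_eq_integral_quarterLine {y : ℝ} (hy : 0 < y) :
    ((Real.exp (-y) : ℝ) : ℂ) = (2 / (Real.pi:ℂ)) *
      ∫ t : ℝ, (y:ℂ) ^ (-(4 * quarterLine t)) * Complex.Gamma (4 * quarterLine t) := by
  have h := exp_neg_eq_mellinBarnes one_pos hy
  have h2 := Measure.integral_comp_mul_left (fun t : ℝ =>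
    (y:ℂ) ^ (-(((1:ℝ):ℂ) + t * Complex.I)) * Complex.Gamma (((1:ℝ):ℂ) + t * Complex.I)) (-4)
  simp only [four_mul_quarterLine]
  rw [h2]
  push_cast at h ⊢
  rw [h]
  have : (Real.pi : ℂ) ≠ 0 := by exact_mod_cast Real.pi_ne_zero
  rw [show |(-4:ℝ)⁻¹| = 1 / 4 by rw [abs_inv]; norm_num, Complex.real_smul]
  generalize (∫ t : ℝ, (y:ℂ) ^ (-((1:ℂ) + t * Complex.I)) *
    Complex.Gamma ((1:ℂ) + t * Complex.I)) = J
  push_cast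
  field_simp
  ring

/-- The Mellin transform of the kernel in its first argument. -/
noncomputable def kernelMellin (τ : ℝ) (w : ℂ) : ℂ :=
  coshTransform τ w * (coshTransform 0 (2 * w) * ((4:ℂ) ^ (-(4 * w)) * Complex.Gamma (4 * w)))

lemma kernelMellin_eq (τ : ℝ) {w : ℂ} (hw : 0 < w.re) :
    kernelMellin τ w = 1 / (8 * (Real.sqrt Real.pi : ℝ)) *
      (Complex.Gamma w * Complex.Gamma (w + 1 / 2) *
      (Complex.Gamma (w + Complex.I * τ) * Complex.Gamma (w - Complex.I * τ))) := by
  have h2 : 0 < (2 * w).re := by simpa using hw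
  have h4 : 0 < (4 * w).re := by simpa using hw
  rw [kernelMellin, coshTransform_eq τ hw, coshTransform_eq 0 h2, Complex.Gamma_mul_Gamma_add_half]
  have n2 := Complex.Gamma_ne_zero_of_re_pos h2
  have n4 := Complex.Gamma_ne_zero_of_re_pos h4
  have np : ((Real.sqrt Real.pi : ℝ) : ℂ) ≠ 0 := by
    exact_mod_cast (Real.sqrt_pos.mpr Real.pi_pos).ne'
  have e1 : (4:ℂ) ^ (-(4 * w)) = ((2:ℂ) ^ w)⁻¹ ^ 8 := by
    rw [show (4:ℂ) = ((2:ℝ):ℂ) * ((2:ℝ):ℂ) by norm_num,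
      Complex.mul_cpow_ofReal_nonneg (by norm_num) (by norm_num), ← Complex.cpow_neg,
      ← Complex.cpow_nat_mul, ← Complex.cpow_add _ _ (by norm_num)]
    push_cast; congr 1; ring
  have e2 : (2:ℂ) ^ (2 * w - 1) = ((2:ℂ) ^ w) ^ 2 / 2 := by
    rw [Complex.cpow_sub _ _ two_ne_zero, Complex.cpow_one, ← Complex.cpow_nat_mul]
    push_cast; rfl
  have e3 : (2:ℂ) ^ (2 * (2 * w) - 1) = ((2:ℂ) ^ w) ^ 4 / 2 := by
    rw [Complex.cpow_sub _ _ two_ne_zero, Complex.cpow_one, ← Complex.cpow_nat_mul]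
    push_cast; congr 2; ring
  have e4 : (2:ℂ) ^ (1 - 2 * w) = 2 * ((2:ℂ) ^ w)⁻¹ ^ 2 := by
    rw [Complex.cpow_sub _ _ two_ne_zero, Complex.cpow_one, inv_pow, ← Complex.cpow_nat_mul]
    push_cast; rfl
  have n5 : (2:ℂ) ^ w ≠ 0 := by simp [Complex.cpow_eq_zero_iff]
  rw [e1, e2, e3, e4]
  rw [show 2 * (2 * w) = 4 * w by ring]
  simp only [Complex.ofReal_zero, mul_zero, add_zero, sub_zero]
  generalize Complex.Gamma (4 * w) = g4 at *
  generalize Complex.Gamma (2 * w) = g2 at *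
  generalize (2:ℂ) ^ w = z at *
  generalize ((Real.sqrt Real.pi : ℝ) : ℂ) = q at *
  field_simp
  ring

lemma integrable_cpow_quarterLine_mul {c : ℝ} (hc : 0 < c) {g : ℝ → ℂ} (hg : Integrable g)
    (a : ℝ) : Integrable fun t : ℝ => (c:ℂ) ^ (-(a * quarterLine t)) * g t := by
  refine hg.bdd_mul (c := c ^ (-(a * (1 / 4)))) ?_ (Eventually.of_forall fun t => ?_)
  · refine Continuous.aestronglyMeasurable ?_
    have := continuous_quarterLine
    exact continuous_const.cpow (by fun_prop) fun _ => Complex.ofReal_mem_slitPlane.mpr hc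
  · rw [Complex.norm_cpow_eq_rpow_re_of_pos hc]
    simp

lemma Complex.ofReal_rpow_cpow {x : ℝ} (hx : 0 < x) (r : ℝ) (z : ℂ) :
    ((x ^ r : ℝ) : ℂ) ^ z = (x:ℂ) ^ ((r:ℂ) * z) := by
  rw [Complex.cpow_def_of_ne_zero (by exact_mod_cast (Real.rpow_pos_of_pos hx r).ne'),
    Complex.cpow_def_of_ne_zero (by exact_mod_cast hx.ne'), ← Complex.ofReal_log hx.le,
    ← Complex.ofReal_log (Real.rpow_pos_of_pos hx r).le, Real.log_rpow hx]
  push_cast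
  ring_nf

lemma integrable_kernelMellin_aux :
    Integrable fun t : ℝ => (4:ℂ) ^ (-(4 * quarterLine t)) * Complex.Gamma (4 * quarterLine t) := by
  simpa using integrable_cpow_quarterLine_mul (c := 4) (by norm_num)
    integrable_Gamma_quarterLine 4

lemma integrable_kernelMellin_inner :
    Integrable fun t : ℝ => coshTransform 0 (2 * quarterLine t) *
      ((4:ℂ) ^ (-(4 * quarterLine t)) * Complex.Gamma (4 * quarterLine t)) :=
  integrable_coshTransform_mul (σ := 1 / 2) (by norm_num) 0
    (w := fun t => 2 * quarterLine t) (continuous_quarterLine.const_mul 2)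
    (fun t => by simp; norm_num) integrable_kernelMellin_aux

lemma integrable_kernelMellin (τ : ℝ) :
    Integrable fun t : ℝ => kernelMellin τ (quarterLine t) :=
  integrable_coshTransform_mul (σ := 1 / 4) (by norm_num) τ continuous_quarterLine
    quarterLine_re integrable_kernelMellin_inner

lemma kernelK_eq_mellinBarnes {x : ℝ} (hx : 0 < x) (τ : ℝ) :
    ((kernelK x τ : ℝ) : ℂ) = (1 / (2 * (Real.pi:ℂ))) *
      ∫ t : ℝ, kernelMellin τ (quarterLine t) * (x:ℂ) ^ (-quarterLine t) := by
  have hin (s : ℝ) : ∫ q : ℝ, ((Real.exp (-(4 * x ^ (1 / 4 : ℝ) * √(Real.cosh s) *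
      Real.cosh q)) : ℝ) : ℂ) = (2 / (Real.pi:ℂ)) * ∫ t : ℝ,
        ((Real.cosh s : ℝ) : ℂ) ^ (-(2 * quarterLine t)) *
        (coshTransform 0 (2 * quarterLine t) * ((4:ℂ) ^ (-(4 * quarterLine t)) *
          Complex.Gamma (4 * quarterLine t)) * (x:ℂ) ^ (-quarterLine t)) := by
    have hc : 0 < Real.cosh s := Real.cosh_pos s
    have hx4 : 0 < x ^ (1 / 4 : ℝ) := by positivity
    have hA : 0 < 4 * x ^ (1 / 4 : ℝ) * √(Real.cosh s) := by positivity
    have h := integral_coshTransform_mul (σ := 1 / 2) (by norm_num) 0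
      (w := fun t => 2 * quarterLine t) (continuous_quarterLine.const_mul 2)
      (fun t => by simp; norm_num) (integrable_cpow_quarterLine_mul hA
        integrable_Gamma_quarterLine 4)
    have e (q : ℝ) : ((Real.exp (-(4 * x ^ (1 / 4 : ℝ) * √(Real.cosh s) *
      Real.cosh q)) : ℝ) : ℂ) = (2 / (Real.pi:ℂ)) * (Complex.exp (2 * Complex.I * (0:ℝ) * q) *
        ∫ t : ℝ, ((Real.cosh q : ℝ) : ℂ) ^ (-(2 * (2 * quarterLine t))) *
          (((4 * x ^ (1 / 4 : ℝ) * √(Real.cosh s) : ℝ) : ℂ) ^ (-(((4:ℝ):ℂ) * quarterLine t)) *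
            Complex.Gamma (4 * quarterLine t))) := by
      rw [exp_neg_eq_integral_quarterLine (mul_pos hA (Real.cosh_pos q))]
      simp only [Complex.ofReal_zero, mul_zero, zero_mul, Complex.exp_zero, one_mul]
      congr 2 with t
      rw [Complex.ofReal_mul (4 * x ^ (1 / 4 : ℝ) * √(Real.cosh s)),
        Complex.mul_cpow_ofReal_nonneg hA.le (Real.cosh_pos q).le]
      push_cast
      ring_nf
    simp only [e]
    rw [integral_const_mul, h]
    congr 2 with t
    have e1 : ((x ^ (1 / 4 : ℝ) : ℝ) : ℂ) ^ (-(4 * quarterLine t)) = (x:ℂ) ^ (-quarterLine t) := by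
      rw [Complex.ofReal_rpow_cpow hx]
      push_cast; congr 1; ring
    have e2 : ((√(Real.cosh s) : ℝ) : ℂ) ^ (-(4 * quarterLine t)) =
        ((Real.cosh s : ℝ) : ℂ) ^ (-(2 * quarterLine t)) := by
      rw [Real.sqrt_eq_rpow, Complex.ofReal_rpow_cpow hc]
      push_cast; congr 1; ring
    rw [Complex.ofReal_mul, Complex.mul_cpow_ofReal_nonneg (by positivity) (by positivity),
      Complex.ofReal_mul, Complex.mul_cpow_ofReal_nonneg (by positivity) (by positivity)]
    push_cast at e1 e2 ⊢
    rw [e1, e2]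
    ring
  rw [kernelK_eq hx]
  simp only [hin]
  have hB := (integrable_cpow_quarterLine_mul hx integrable_kernelMellin_inner 1)
  simp only [Complex.ofReal_one, one_mul] at hB
  have h := integral_coshTransform_mul (σ := 1 / 4) (by norm_num) τ continuous_quarterLine
    quarterLine_re hB
  have e (s : ℝ) (J : ℂ) : Complex.exp (2 * Complex.I * τ * s) * ((2 / (Real.pi:ℂ)) * J) =
    (2 / (Real.pi:ℂ)) * (Complex.exp (2 * Complex.I * τ * s) * J) := by ring
  simp only [e]
  rw [integral_const_mul]
  have e1 (s : ℝ) : ∫ t : ℝ, ((Real.cosh s : ℝ) : ℂ) ^ (-(2 * quarterLine t)) *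
        (coshTransform 0 (2 * quarterLine t) * ((4:ℂ) ^ (-(4 * quarterLine t)) *
          Complex.Gamma (4 * quarterLine t)) * (x:ℂ) ^ (-quarterLine t)) =
      ∫ t : ℝ, ((Real.cosh s : ℝ) : ℂ) ^ (-(2 * quarterLine t)) *
        ((x:ℂ) ^ (-quarterLine t) * (coshTransform 0 (2 * quarterLine t) *
          ((4:ℂ) ^ (-(4 * quarterLine t)) * Complex.Gamma (4 * quarterLine t)))) := by
    congr 1 with t; ring
  simp only [e1]
  rw [h, ← mul_assoc]
  congr 1
  · field_simp; norm_num
  · congr 1 with t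
    rw [kernelMellin]; ring

/-- Fubini for a function of `x` against an integral of powers `x ^ w t` along a vertical line. -/
lemma integral_mul_integral_cpow_swap {σ : ℝ} {w h g : ℝ → ℂ} (hw : Continuous w)
    (hre : ∀ t, (w t).re = σ) (hh : Integrable h)
    (hg : IntegrableOn (fun x : ℝ => ((x ^ σ : ℝ) : ℂ) * g x) (Ioi 0)) :
    ∫ x in Ioi (0:ℝ), g x * ∫ t : ℝ, h t * (x:ℂ) ^ w t =
      ∫ t : ℝ, h t * ∫ x in Ioi (0:ℝ), g x * (x:ℂ) ^ w t := by
  have hprod : Integrable (fun p : ℝ × ℝ => (((p.1 ^ σ : ℝ) : ℂ) * g p.1 * h p.2) *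
      ((((p.1 ^ (-σ) : ℝ) : ℂ)) * (p.1:ℂ) ^ w p.2)) ((volume.restrict (Ioi 0)).prod volume) := by
    refine (Integrable.mul_prod hg hh).mul_bdd (c := 1) ?_ ?_
    · have : Measurable w := hw.measurable
      exact (by fun_prop : Measurable fun p : ℝ × ℝ =>
        (((p.1 ^ (-σ) : ℝ) : ℂ)) * (p.1:ℂ) ^ w p.2).aestronglyMeasurable
    · have : ∀ᵐ p : ℝ × ℝ ∂((volume.restrict (Ioi 0)).prod volume), p.1 ∈ Ioi (0:ℝ) :=
        Measure.quasiMeasurePreserving_fst.ae (ae_restrict_mem measurableSet_Ioi)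
      filter_upwards [this] with p hp
      have hp : 0 < p.1 := hp
      rw [norm_mul, Complex.norm_cpow_eq_rpow_re_of_pos hp, hre, Complex.norm_real,
        Real.norm_of_nonneg (by positivity), ← Real.rpow_add hp]
      simp
  have e (x : ℝ) (hx : x ∈ Ioi (0:ℝ)) : g x * ∫ t : ℝ, h t * (x:ℂ) ^ w t =
      ∫ t : ℝ, ((((x ^ σ : ℝ) : ℂ) * g x * h t) * ((((x ^ (-σ) : ℝ) : ℂ)) * (x:ℂ) ^ w t)) := by
    rw [← integral_const_mul]
    congr 1 with t
    have hx : 0 < x := hx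
    have : ((x ^ σ : ℝ) : ℂ) * ((x ^ (-σ) : ℝ) : ℂ) = 1 := by
      rw [← Complex.ofReal_mul, ← Real.rpow_add hx]; simp
    linear_combination (-g x * (h t * (x:ℂ) ^ w t)) * this
  rw [setIntegral_congr_fun measurableSet_Ioi e, integral_integral_swap hprod]
  congr 1 with t
  rw [← integral_const_mul]
  refine setIntegral_congr_fun measurableSet_Ioi fun x hx => ?_
  have hx : 0 < x := hx
  have : ((x ^ σ : ℝ) : ℂ) * ((x ^ (-σ) : ℝ) : ℂ) = 1 := by
    rw [← Complex.ofReal_mul, ← Real.rpow_add hx]; simp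
  linear_combination (g x * (h t * (x:ℂ) ^ w t)) * this

lemma mellinConvergent_ofReal {f : ℝ → ℝ} {a b σ : ℝ} (hf : LocallyIntegrableOn f (Ioi 0))
    (ha : a < σ) (hb : σ < b) (hO0 : f =O[nhdsWithin 0 (Ioi 0)] fun x => x ^ (-a))
    (hOinf : f =O[atTop] fun x => x ^ (-b)) {s : ℂ} (hs : s.re = σ) :
    MellinConvergent (fun x => (f x : ℂ)) s := by
  have hfc : LocallyIntegrableOn (fun x => (f x : ℂ)) (Ioi 0) := fun x hx =>
    let ⟨u, hu, h⟩ := hf x hx; ⟨u, hu, h.ofReal⟩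
  exact mellinConvergent_of_isBigO_rpow hfc (Complex.isBigO_ofReal_left.mpr hOinf) (by rwa [hs])
    (Complex.isBigO_ofReal_left.mpr hO0) (by rwa [hs])

lemma mellinT_eq_mellin (f : ℝ → ℝ) (s : ℂ) : mellinT f s = mellin (fun x => (f x : ℂ)) s := by
  simp only [mellinT, mellin, smul_eq_mul, mul_comm]

lemma indexF_eq_integral_mellinT {f : ℝ → ℝ} {a b : ℝ} (hf : LocallyIntegrableOn f (Ioi 0))
    (ha : a < 3 / 4) (hb : 3 / 4 < b) (hO0 : f =O[nhdsWithin 0 (Ioi 0)] fun x => x ^ (-a))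
    (hOinf : f =O[atTop] fun x => x ^ (-b)) (τ : ℝ) :
    ((indexF f τ : ℝ) : ℂ) = (1 / (2 * (Real.pi:ℂ))) *
      ∫ t : ℝ, kernelMellin τ (quarterLine t) * mellinT f (1 - quarterLine t) := by
  have hc := mellinConvergent_ofReal hf ha hb hO0 hOinf (s := 3 / 4) (by norm_num)
  have hg : IntegrableOn (fun x : ℝ => ((x ^ (-(1 / 4) : ℝ) : ℝ) : ℂ) * (f x : ℂ)) (Ioi 0) := by
    unfold MellinConvergent at hc
    refine hc.congr_fun (fun x hx => ?_) measurableSet_Ioi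
    have hx : 0 < x := hx
    simp only [smul_eq_mul]
    rw [Complex.ofReal_cpow hx.le]
    push_cast; congr 2; norm_num
  have h := integral_mul_integral_cpow_swap (w := fun t => -quarterLine t)
    continuous_quarterLine.neg (fun t => by simp) (integrable_kernelMellin τ) hg
  have e (t : ℝ) : mellinT f (1 - quarterLine t) =
      ∫ x in Ioi (0:ℝ), (f x : ℂ) * (x:ℂ) ^ (-quarterLine t) := by
    rw [mellinT]; ring_nf
  simp only [e]
  rw [← h, indexF, ← integral_complex_ofReal, ← integral_const_mul]
  refine setIntegral_congr_fun measurableSet_Ioi fun x hx => ?_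
  rw [Complex.ofReal_mul, kernelK_eq_mellinBarnes hx]
  ring

/-- Vertical line integrals of a holomorphic function which is `O(1 / (im z) ^ 2)` in a strip do not
depend on the line. -/
lemma integral_vertical_eq_of_differentiableOn {F : ℂ → ℂ} {σ₁ σ₂ C : ℝ} (hσ : σ₁ ≤ σ₂)
    (hF : DifferentiableOn ℂ F {z | z.re ∈ Icc σ₁ σ₂})
    (hC : ∀ z : ℂ, z.re ∈ Icc σ₁ σ₂ → 1 ≤ |z.im| → ‖F z‖ ≤ C / z.im ^ 2) :
    ∫ t : ℝ, F (σ₁ + t * Complex.I) = ∫ t : ℝ, F (σ₂ + t * Complex.I) := by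
  have hint (σ : ℝ) (h : σ ∈ Icc σ₁ σ₂) : Integrable fun t : ℝ => F (σ + t * Complex.I) := by
    refine integrable_of_norm_le_div_sq (C := C) ?_ fun t ht => ?_
    · exact hF.continuousOn.comp_continuous (by fun_prop) fun t => by simpa using h
    · simpa using hC (σ + t * Complex.I) (by simpa using h) (by simpa using ht)
  have hlim (σ : ℝ) (h : σ ∈ Icc σ₁ σ₂) : Tendsto (fun T : ℝ => ∫ t in (-T)..T,
      F (σ + t * Complex.I)) atTop (nhds (∫ t : ℝ, F (σ + t * Complex.I))) :=
    intervalIntegral_tendsto_integral (hint σ h) tendsto_neg_atTop_atBot tendsto_id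
  have h0 (ε : ℝ) (hε : |ε| = 1) : Tendsto (fun T : ℝ => ∫ x in σ₁..σ₂,
      F (x + ((ε * T : ℝ):ℂ) * Complex.I)) atTop (nhds 0) := by
    have hlim0 : Tendsto (fun T : ℝ => C / T ^ 2 * |σ₂ - σ₁|) atTop (nhds 0) := by
      have := (tendsto_pow_atTop (α := ℝ) two_ne_zero).const_div_atTop C
      simpa using this.mul_const |σ₂ - σ₁|
    refine squeeze_zero_norm' ?_ hlim0
    filter_upwards [eventually_ge_atTop 1] with T hT
    refine intervalIntegral.norm_integral_le_of_norm_le_const fun x hx => ?_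
    rw [uIoc_of_le hσ] at hx
    have h1 : |ε * T| = T := by rw [abs_mul, hε, one_mul, abs_of_pos (by linarith)]
    have := hC (x + ((ε * T : ℝ):ℂ) * Complex.I) (by simpa using ⟨hx.1.le, hx.2⟩)
      (by simpa [h1, -Complex.ofReal_mul] using hT)
    have h2 : (ε * T) ^ 2 = T ^ 2 := by rw [← sq_abs, h1]
    simpa [h2, -Complex.ofReal_mul] using this
  have hrect (T : ℝ) : (∫ t in (-T)..T, F (σ₂ + t * Complex.I)) -
      (∫ t in (-T)..T, F (σ₁ + t * Complex.I)) = Complex.I * ((∫ x in σ₁..σ₂,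
      F (x + (((-1) * T : ℝ):ℂ) * Complex.I)) - ∫ x in σ₁..σ₂, F (x + ((1 * T : ℝ):ℂ) * Complex.I))
      := by
    have h := Complex.integral_boundary_rect_eq_zero_of_differentiableOn F
      (σ₁ + ((-T : ℝ) : ℂ) * Complex.I) (σ₂ + (T : ℂ) * Complex.I) (hF.mono fun z hz => by
        have := hz.1
        simpa [uIcc_of_le hσ] using this)
    simp only [Complex.add_re, Complex.ofReal_re, Complex.mul_re, Complex.I_re, mul_zero,
      Complex.ofReal_im, Complex.I_im, mul_one, sub_self, add_zero, Complex.add_im,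
      Complex.mul_im, zero_add, smul_eq_mul] at h
    rw [neg_one_mul, one_mul]
    linear_combination (-Complex.I) * h + ((∫ t in (-T)..T, F (σ₂ + t * Complex.I)) -
      (∫ t in (-T)..T, F (σ₁ + t * Complex.I))) * Complex.I_sq
  have hz : Tendsto (fun T : ℝ => (∫ t in (-T)..T, F (σ₂ + t * Complex.I)) -
      (∫ t in (-T)..T, F (σ₁ + t * Complex.I))) atTop (nhds 0) := by
    simp only [hrect]
    simpa using ((h0 (-1) (by simp)).sub (h0 1 (by simp))).const_mul Complex.I
  have := tendsto_nhds_unique hz ((hlim σ₂ ⟨hσ, le_rfl⟩).sub (hlim σ₁ ⟨le_rfl, hσ⟩))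
  exact (sub_eq_zero.mp this.symm).symm

/-- The Gamma factor in the definition of `phiFn`. -/
noncomputable def gammaWeight (s : ℂ) : ℂ :=
  Complex.Gamma (1 - s) * Complex.Gamma (3 / 2 - s) * Complex.Gamma s / Complex.Gamma (s - 1 / 2)

lemma gammaWeight_eq (s : ℂ) (hs : s.re < 1) :
    gammaWeight s = -(Complex.cos (Real.pi * s) / Complex.sin (Real.pi * s)) *
      Complex.Gamma (3 / 2 - s) ^ 2 := by
  have h1 := Complex.Gamma_mul_Gamma_one_sub s
  have h2 := Complex.Gamma_mul_Gamma_one_sub (s - 1 / 2)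
  have h3 : Complex.sin (Real.pi * (s - 1 / 2)) = -Complex.cos (Real.pi * s) := by
    rw [show (Real.pi:ℂ) * (s - 1 / 2) = Real.pi * s - Real.pi / 2 by ring,
      Complex.sin_sub_pi_div_two]
  rw [h3, show 1 - (s - 1 / 2) = 3 / 2 - s by ring] at h2
  have hp : (Real.pi : ℂ) ≠ 0 := by exact_mod_cast Real.pi_ne_zero
  have hG : Complex.Gamma (3 / 2 - s) ≠ 0 :=
    Complex.Gamma_ne_zero_of_re_pos (by norm_num; linarith)
  rw [gammaWeight, show Complex.Gamma (1 - s) * Complex.Gamma (3 / 2 - s) * Complex.Gamma s =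
    (Complex.Gamma s * Complex.Gamma (1 - s)) * Complex.Gamma (3 / 2 - s) by ring, h1]
  by_cases hc : Complex.cos (Real.pi * s) = 0
  · rw [hc] at h2 ⊢
    have : Complex.Gamma (s - 1 / 2) = 0 := by simpa [hG] using h2
    rw [this]; simp
  · have hg : Complex.Gamma (s - 1 / 2) = -Real.pi / (Complex.cos (Real.pi * s) *
        Complex.Gamma (3 / 2 - s)) := by
      rw [eq_div_iff (mul_ne_zero hc hG)]
      rw [div_neg, ← neg_div, eq_div_iff hc] at h2
      linear_combination h2
    rw [hg]
    by_cases hs0 : Complex.sin (Real.pi * s) = 0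
    · simp [hs0]
    field_simp

lemma norm_cos_div_sin_le {z : ℂ} (hz : 1 ≤ |z.im|) : ‖Complex.cos z / Complex.sin z‖ ≤ 2 := by
  have hc : ‖Complex.cos z‖ ^ 2 = Real.cos z.re ^ 2 + Real.sinh z.im ^ 2 := by
    have e : Complex.cos z = ((Real.cos z.re * Real.cosh z.im : ℝ) : ℂ) +
        ((-(Real.sin z.re * Real.sinh z.im) : ℝ) : ℂ) * Complex.I := by
      rw [Complex.cos_eq]; push_cast; ring
    rw [e, Complex.sq_norm, Complex.normSq_add_mul_I, mul_pow, neg_sq, mul_pow, Real.cosh_sq,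
      Real.sin_sq]
    ring
  have hsn : ‖Complex.sin z‖ ^ 2 = Real.sin z.re ^ 2 + Real.sinh z.im ^ 2 := by
    have e : Complex.sin z = ((Real.sin z.re * Real.cosh z.im : ℝ) : ℂ) +
        ((Real.cos z.re * Real.sinh z.im : ℝ) : ℂ) * Complex.I := by
      rw [Complex.sin_eq]; push_cast; ring
    rw [e, Complex.sq_norm, Complex.normSq_add_mul_I, mul_pow, mul_pow, Real.cosh_sq,
      Real.sin_sq]
    ring
  have h1 : 1 ≤ Real.sinh z.im ^ 2 := by
    rw [← sq_abs, Real.abs_sinh]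
    have := Real.self_le_sinh_iff.mpr (abs_nonneg z.im)
    nlinarith
  have hpos : 0 < ‖Complex.sin z‖ := by
    rcases (norm_nonneg (Complex.sin z)).eq_or_lt with h | h
    · rw [← h] at hsn; nlinarith [sq_nonneg (Real.sin z.re)]
    · exact h
  rw [norm_div, div_le_iff₀ hpos]
  refine abs_le_of_sq_le_sq' ?_ (by positivity) |>.2
  rw [mul_pow, hc, hsn]
  nlinarith [Real.cos_sq_le_one z.re, sq_nonneg (Real.sin z.re)]

lemma exists_norm_gammaWeight_le {σ₁ σ₂ : ℝ} (h₂ : σ₂ < 1) :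
    ∃ C, ∀ z : ℂ, z.re ∈ Icc σ₁ σ₂ → 1 ≤ |z.im| → ‖gammaWeight z‖ ≤ C / z.im ^ 2 := by
  obtain ⟨M, hM⟩ := isCompact_Icc.exists_bound_of_continuousOn (s := Icc σ₁ σ₂)
    (f := fun σ => Real.Gamma (3 / 2 - σ) * Real.Gamma (3 / 2 - σ + 2)) (by
      refine ContinuousOn.mul ?_ ?_ <;>
      · refine fun σ hσ => ContinuousAt.continuousWithinAt ?_
        refine ContinuousAt.comp (g := Real.Gamma) ?_ (by fun_prop)
        refine (Real.differentiableAt_Gamma fun m hm => ?_).continuousAt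
        have : (0:ℝ) ≤ m := m.cast_nonneg
        linarith [hσ.2])
  refine ⟨2 * M, fun z hz hi => ?_⟩
  have hre : 0 < (3 / 2 - z).re := by norm_num; linarith [hz.2]
  have hi0 : (3 / 2 - z).im ≠ 0 := by
    intro h; norm_num at h; rw [h] at hi; norm_num at hi
  rw [gammaWeight_eq z (hz.2.trans_lt h₂), norm_mul, norm_neg, sq, norm_mul]
  have h1 : ‖Complex.cos (Real.pi * z) / Complex.sin (Real.pi * z)‖ ≤ 2 := by
    refine norm_cos_div_sin_le ?_
    rw [Complex.im_ofReal_mul, abs_mul, abs_of_pos Real.pi_pos]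
    nlinarith [Real.pi_gt_three]
  have h2 := Complex.norm_Gamma_le_Gamma_re hre
  have h3 := Complex.norm_Gamma_le_div_im_sq hre hi0
  have h4 := (le_abs_self _).trans (hM z.re hz)
  have e1 : (3 / 2 - z).re = 3 / 2 - z.re := by norm_num
  have e2 : (3 / 2 - z).im ^ 2 = z.im ^ 2 := by norm_num
  rw [e1] at h2 h3
  rw [e2] at h3
  have hp : 0 < Real.Gamma (3 / 2 - z.re) := Real.Gamma_pos_of_pos (by rwa [e1] at hre)
  calc _ ≤ 2 * (Real.Gamma (3 / 2 - z.re) * (Real.Gamma (3 / 2 - z.re + 2) / z.im ^ 2)) := by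
        gcongr
    _ = 2 * (Real.Gamma (3 / 2 - z.re) * Real.Gamma (3 / 2 - z.re + 2)) / z.im ^ 2 := by ring
    _ ≤ _ := by gcongr

lemma differentiableAt_gammaWeight {s : ℂ} (h0 : 0 < s.re) (h1 : s.re < 1) :
    DifferentiableAt ℂ gammaWeight s := by
  have hG {z : ℂ} (hz : 0 < z.re) : DifferentiableAt ℂ Complex.Gamma z :=
    Complex.differentiableAt_Gamma _ fun m hm => by
      have : (0:ℝ) ≤ m := m.cast_nonneg
      rw [hm] at hz; simp at hz; linarith
  unfold gammaWeight
  simp only [div_eq_mul_inv]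
  refine DifferentiableAt.mul (((DifferentiableAt.comp s (hG (by simpa using h1)) (by fun_prop)).mul
    (DifferentiableAt.comp s (hG (by norm_num; linarith)) (by fun_prop))).mul (hG h0)) ?_
  exact DifferentiableAt.comp (g := fun z => (Complex.Gamma z)⁻¹) s
    Complex.differentiable_one_div_Gamma.differentiableAt (by fun_prop)

lemma exists_norm_mellinT_le {f : ℝ → ℝ} {a b σ₁ σ₂ : ℝ} (hf : LocallyIntegrableOn f (Ioi 0))
    (h₁ : a < σ₁) (h : σ₁ ≤ σ₂) (h₂ : σ₂ < b)
    (hO0 : f =O[nhdsWithin 0 (Ioi 0)] fun x => x ^ (-a))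
    (hOinf : f =O[atTop] fun x => x ^ (-b)) :
    ∃ C, ∀ z : ℂ, z.re ∈ Icc σ₁ σ₂ → ‖mellinT f z‖ ≤ C := by
  have hn (σ : ℝ) (ha : a < σ) (hb : σ < b) :
      IntegrableOn (fun x : ℝ => x ^ (σ - 1) * |f x|) (Ioi 0) := by
    have := mellinConvergent_ofReal hf ha hb hO0 hOinf (s := σ) (by simp)
    unfold MellinConvergent at this
    refine IntegrableOn.congr_fun this.norm (fun x hx => ?_) measurableSet_Ioi
    simp [Complex.norm_cpow_eq_rpow_re_of_pos hx]
  refine ⟨∫ x in Ioi (0:ℝ), (x ^ (σ₁ - 1) * |f x| + x ^ (σ₂ - 1) * |f x|), fun z hz => ?_⟩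
  refine norm_integral_le_of_norm_le ((hn σ₁ h₁ (h.trans_lt h₂)).add (hn σ₂ (h₁.trans_le h) h₂)) ?_
  refine (ae_restrict_iff' measurableSet_Ioi).mpr (Eventually.of_forall fun x hx => ?_)
  have hx : 0 < x := hx
  rw [norm_mul, Complex.norm_cpow_eq_rpow_re_of_pos hx, Complex.norm_real, Real.norm_eq_abs,
    ← add_mul, mul_comm]
  gcongr
  rcases le_total 1 x with h1 | h1
  · exact (Real.rpow_le_rpow_of_exponent_le h1 (by simpa using hz.2)).trans
      (le_add_of_nonneg_left (by positivity))
  · exact (Real.rpow_le_rpow_of_exponent_ge hx h1 (by simpa using hz.1)).trans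
      (le_add_of_nonneg_right (by positivity))

lemma differentiableAt_mellinT {f : ℝ → ℝ} {a b : ℝ} (hf : LocallyIntegrableOn f (Ioi 0))
    (hO0 : f =O[nhdsWithin 0 (Ioi 0)] fun x => x ^ (-a))
    (hOinf : f =O[atTop] fun x => x ^ (-b)) {z : ℂ} (h₁ : a < z.re) (h₂ : z.re < b) :
    DifferentiableAt ℂ (mellinT f) z := by
  have hfc : LocallyIntegrableOn (fun x => (f x : ℂ)) (Ioi 0) := fun x hx =>
    let ⟨u, hu, h⟩ := hf x hx; ⟨u, hu, h.ofReal⟩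
  rw [show mellinT f = mellin (fun x => (f x : ℂ)) from funext (mellinT_eq_mellin f)]
  exact mellin_differentiableAt_of_isBigO_rpow hfc (Complex.isBigO_ofReal_left.mpr hOinf) h₂
    (Complex.isBigO_ofReal_left.mpr hO0) h₁

section phi

variable {f : ℝ → ℝ} {a b σ₁ σ₂ : ℝ}

lemma exists_norm_gammaWeight_mul_mellinT_le (hf : LocallyIntegrableOn f (Ioi 0))
    (h₁ : a < σ₁) (h : σ₁ ≤ σ₂) (h₂ : σ₂ < b) (h₂' : σ₂ < 1)
    (hO0 : f =O[nhdsWithin 0 (Ioi 0)] fun x => x ^ (-a))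
    (hOinf : f =O[atTop] fun x => x ^ (-b)) :
    ∃ C, ∀ z : ℂ, z.re ∈ Icc σ₁ σ₂ → 1 ≤ |z.im| →
      ‖gammaWeight z * mellinT f z‖ ≤ C / z.im ^ 2 := by
  obtain ⟨A, hA⟩ := exists_norm_gammaWeight_le (σ₁ := σ₁) h₂'
  obtain ⟨B, hB⟩ := exists_norm_mellinT_le hf h₁ h h₂ hO0 hOinf
  refine ⟨A * B, fun z hz hi => ?_⟩
  rw [norm_mul, mul_div_right_comm]
  have hA' := hA z hz hi
  have : 0 ≤ A / z.im ^ 2 := (norm_nonneg _).trans hA'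
  gcongr
  exact hB z hz

lemma differentiableOn_gammaWeight_mul_mellinT (hf : LocallyIntegrableOn f (Ioi 0))
    (h₁ : a < σ₁) (h₁' : 0 < σ₁) (h₂ : σ₂ < b) (h₂' : σ₂ < 1)
    (hO0 : f =O[nhdsWithin 0 (Ioi 0)] fun x => x ^ (-a))
    (hOinf : f =O[atTop] fun x => x ^ (-b)) :
    DifferentiableOn ℂ (fun z => gammaWeight z * mellinT f z) {z | z.re ∈ Icc σ₁ σ₂} := fun _ hz =>
  ((differentiableAt_gammaWeight (h₁'.trans_le hz.1) (hz.2.trans_lt h₂')).mul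
    (differentiableAt_mellinT hf hO0 hOinf (h₁.trans_le hz.1)
      (hz.2.trans_lt h₂))).differentiableWithinAt

lemma integrable_gammaWeight_mul_mellinT {σ : ℝ} (hf : LocallyIntegrableOn f (Ioi 0))
    (h₁ : a < σ) (h₁' : 0 < σ) (h₂ : σ < b) (h₂' : σ < 1)
    (hO0 : f =O[nhdsWithin 0 (Ioi 0)] fun x => x ^ (-a))
    (hOinf : f =O[atTop] fun x => x ^ (-b)) :
    Integrable fun t : ℝ => gammaWeight (σ + t * Complex.I) * mellinT f (σ + t * Complex.I) := by
  obtain ⟨C, hC⟩ := exists_norm_gammaWeight_mul_mellinT_le hf h₁ le_rfl h₂ h₂' hO0 hOinf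
  refine integrable_of_norm_le_div_sq (C := C) ?_ fun t ht => ?_
  · exact (differentiableOn_gammaWeight_mul_mellinT hf h₁ h₁' h₂ h₂' hO0
      hOinf).continuousOn.comp_continuous (by fun_prop) fun t => by simp
  · simpa using hC (σ + t * Complex.I) (by simp) (by simpa using ht)

lemma one_sub_quarterLine (t : ℝ) : 1 - quarterLine t = ((3 / 4 : ℝ) : ℂ) + t * Complex.I := by
  rw [quarterLine]; push_cast; ring

lemma phiFn_eq_integral_quarterLine {ν : ℝ} (hf : LocallyIntegrableOn f (Ioi 0))
    (h₁ : a < ν) (h₁' : 0 < ν) (h : ν ≤ 3 / 4) (h₂ : 3 / 4 < b)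
    (hO0 : f =O[nhdsWithin 0 (Ioi 0)] fun x => x ^ (-a))
    (hOinf : f =O[atTop] fun x => x ^ (-b)) {x : ℝ} (hx : 0 < x) :
    phiFn f ν x = (1 / (2 * (Real.pi:ℂ))) * ∫ t : ℝ, gammaWeight (1 - quarterLine t) *
      mellinT f (1 - quarterLine t) * (x:ℂ) ^ (-(1 - quarterLine t)) := by
  obtain ⟨C, hC⟩ := exists_norm_gammaWeight_mul_mellinT_le hf h₁ h h₂ (by norm_num) hO0 hOinf
  have hd := differentiableOn_gammaWeight_mul_mellinT (σ₂ := 3 / 4) hf h₁ h₁' h₂ (by norm_num)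
    hO0 hOinf
  have key := integral_vertical_eq_of_differentiableOn
    (F := fun z => gammaWeight z * mellinT f z * (x:ℂ) ^ (-z))
    (C := C * (x ^ (-ν) + x ^ (-(3 / 4) : ℝ))) h
    (hd.mul fun z _ => DifferentiableAt.differentiableWithinAt
      (by exact (differentiableAt_id.neg).const_cpow (Or.inl (by exact_mod_cast hx.ne'))))
    (fun z hz hi => by
      rw [norm_mul, Complex.norm_cpow_eq_rpow_re_of_pos hx, mul_div_right_comm]
      have hC' := hC z hz hi
      have : 0 ≤ C / z.im ^ 2 := (norm_nonneg _).trans hC'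
      gcongr
      rcases le_total 1 x with h1 | h1
      · exact (Real.rpow_le_rpow_of_exponent_le h1 (by simpa using hz.1)).trans
          (le_add_of_nonneg_right (by positivity))
      · exact (Real.rpow_le_rpow_of_exponent_ge hx h1 (by simpa using hz.2)).trans
          (le_add_of_nonneg_left (by positivity)))
  simp only [one_sub_quarterLine]
  rw [← key, phiFn]
  congr 2 with t
  rw [gammaWeight]
  ring

end phi

lemma integrable_tsum_of_summable_integral_norm {α E : Type*} [MeasurableSpace α] {μ : Measure α}
    [NormedAddCommGroup E] [NormedSpace ℝ E] [CompleteSpace E] {F : ℕ → α → E}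
    (hF : ∀ n, Integrable (F n) μ) (hs : Summable fun n => ∫ a, ‖F n a‖ ∂μ) :
    Integrable (fun a => ∑' n, F n a) μ := by
  have h1 : ∑' n, ‖(hF n).toL1 (F n)‖ₑ ≠ ⊤ := by
    rw [tsum_enorm_ne_top_iff_summable_norm]
    refine hs.congr fun n => ?_
    rw [L1.norm_of_fun_eq_integral_norm]
  refine (L1.integrable_coeFn (∑' n, (hF n).toL1 (F n))).congr ?_
  have h2 := ae_all_iff.mpr fun n => (hF n).coeFn_toL1
  filter_upwards [Lp.coeFn_tsum h1, h2] with a ha hb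
  rw [ha]
  simp only [hb]

lemma Complex.hasSum_Gamma_add_nat_mul_pow {w : ℂ} (hw : 0 < w.re) {u : ℂ} (hu : ‖u‖ < 1) :
    HasSum (fun n : ℕ => Complex.Gamma (w + n) / n.factorial * u ^ n)
      (Complex.Gamma w * (1 - u) ^ (-w)) := by
  have h := (Complex.one_div_one_sub_cpow_hasFPowerSeriesOnBall_zero w).hasSum (y := u)
    (by simpa [enorm_eq_nnnorm, ← NNReal.coe_lt_one] using hu)
  have h' := h.mul_left (Complex.Gamma w)
  rw [zero_add, one_div, ← Complex.cpow_neg] at h'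
  refine h'.congr_fun fun n => ?_
  have hG : Complex.Gamma w ≠ 0 := Complex.Gamma_ne_zero_of_re_pos hw
  have hP := Complex.Gamma_add_nat_div_Gamma_eq (n := n) w fun k hk => by
    rw [hk] at hw; simp at hw; linarith [(k.cast_nonneg : (0:ℝ) ≤ k)]
  have hM := Ring.factorial_nsmul_multichoose_eq_ascPochhammer w n
  rw [Polynomial.ascPochhammer_smeval_eq_eval, ← hP, nsmul_eq_mul] at hM
  have hc : Ring.choose (w + n - 1) n = Ring.multichoose w n := by
    rw [Ring.choose]; congr 1; ring
  have hf : (n.factorial : ℂ) ≠ 0 := by exact_mod_cast n.factorial_ne_zero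
  rw [FormalMultilinearSeries.ofScalars_apply_eq, hc, smul_eq_mul, ← mul_assoc]
  congr 1
  rw [eq_div_iff hG] at hM
  rw [← hM]
  field_simp

lemma Real.Gamma_add_nat_le {σ : ℝ} (h0 : 0 < σ) (h1 : σ < 1) {n : ℕ} (hn : 0 < n) :
    Real.Gamma (σ + n) / n.factorial ≤ (n:ℝ) ^ (σ - 1) := by
  have hn' : (0:ℝ) < n := by exact_mod_cast hn
  have h := Real.Gamma_mul_add_mul_le_rpow_Gamma_mul_rpow_Gamma (s := n) (t := n + 1) (a := 1 - σ)
    (b := σ) hn' (by positivity) (by linarith) h0 (by ring)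
  have hG : Real.Gamma (n + 1) = n.factorial := Real.Gamma_nat_eq_factorial n
  have hG' : Real.Gamma n = n.factorial / n := by
    rw [← hG, Real.Gamma_add_one hn'.ne']; field_simp
  have hf : (0:ℝ) < n.factorial := by exact_mod_cast n.factorial_pos
  rw [hG, hG', show (1 - σ) * n + σ * (n + 1) = σ + n by ring, Real.div_rpow hf.le hn'.le,
    div_mul_eq_mul_div, ← Real.rpow_add hf, sub_add_cancel, Real.rpow_one] at h
  rw [div_le_iff₀ hf, show σ - 1 = -(1 - σ) by ring, Real.rpow_neg hn'.le]
  rwa [inv_mul_eq_div]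

lemma Real.summable_Gamma_add_nat_div_factorial_sq {σ : ℝ} (h0 : 0 < σ) (h1 : σ < 1 / 2) :
    Summable fun n : ℕ => (Real.Gamma (σ + n) / n.factorial) ^ 2 := by
  refine Summable.of_norm_bounded_eventually_nat (g := fun n : ℕ => (n:ℝ) ^ (2 * (σ - 1)))
    (Real.summable_nat_rpow.mpr (by linarith)) ?_
  filter_upwards [eventually_gt_atTop 0] with n hn
  have hp : 0 ≤ Real.Gamma (σ + n) / n.factorial :=
    div_nonneg (Real.Gamma_pos_of_pos (by positivity)).le (by positivity)
  rw [Real.norm_of_nonneg (by positivity), mul_comm, Real.rpow_mul (by positivity)]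
  exact_mod_cast pow_le_pow_left₀ hp (Real.Gamma_add_nat_le h0 (by linarith) hn) 2

lemma Complex.factorial_mul_norm_Gamma_le {μ : ℂ} (hμ : 0 ≤ μ.re) (n : ℕ) :
    n.factorial * ‖Complex.Gamma (μ + 1)‖ ≤ ‖Complex.Gamma (μ + n + 1)‖ := by
  induction n with
  | zero => simp
  | succ n ih =>
    have hre : (n + 1 : ℝ) ≤ (μ + n + 1).re := by simpa using hμ
    have hne : μ + n + 1 ≠ 0 := fun h => by
      rw [h, Complex.zero_re] at hre; linarith [(n.cast_nonneg : (0:ℝ) ≤ n)]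
    rw [Nat.cast_succ, ← add_assoc, Complex.Gamma_add_one _ hne, norm_mul, Nat.factorial_succ]
    push_cast
    rw [mul_assoc]
    exact mul_le_mul (hre.trans (Complex.re_le_norm _)) ih (by positivity) (norm_nonneg _)

lemma Complex.integrableOn_beta {s t : ℂ} (hs : 0 < s.re) (ht : 0 < t.re) :
    IntegrableOn (fun u : ℝ => (u:ℂ) ^ (s - 1) * (1 - (u:ℂ)) ^ (t - 1)) (Ioo 0 1) := by
  have := Complex.betaIntegral_convergent hs ht
  rw [intervalIntegrable_iff_integrableOn_Ioo_of_le zero_le_one] at this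
  exact this

lemma Complex.integral_beta {s t : ℂ} (hs : 0 < s.re) (ht : 0 < t.re) :
    ∫ u : ℝ in Ioo 0 1, (u:ℂ) ^ (s - 1) * (1 - (u:ℂ)) ^ (t - 1) =
      Complex.Gamma s * Complex.Gamma t / Complex.Gamma (s + t) := by
  rw [Complex.Gamma_mul_Gamma_eq_betaIntegral hs ht, mul_div_cancel_left₀ _
    (Complex.Gamma_ne_zero_of_re_pos (by simp; linarith)), Complex.betaIntegral,
    intervalIntegral.integral_of_le zero_le_one, integral_Ioc_eq_integral_Ioo]

lemma Complex.integral_norm_beta {s t : ℂ} (hs : 0 < s.re) (ht : 0 < t.re) :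
    ∫ u : ℝ in Ioo 0 1, ‖(u:ℂ) ^ (s - 1) * (1 - (u:ℂ)) ^ (t - 1)‖ =
      Real.Gamma s.re * Real.Gamma t.re / Real.Gamma (s.re + t.re) := by
  have h := Complex.integral_beta (s := s.re) (t := t.re) (by simpa) (by simpa)
  rw [← Complex.ofReal_inj, ← integral_complex_ofReal]
  push_cast [← Complex.Gamma_ofReal]
  rw [← h]
  refine setIntegral_congr_fun measurableSet_Ioo fun u hu => ?_
  have h0 : 0 < u := hu.1
  have h1 : 0 < 1 - u := sub_pos.mpr hu.2
  have e : (1 - (u:ℂ)) = ((1 - u : ℝ) : ℂ) := by push_cast; rfl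
  rw [e, norm_mul, Complex.ofReal_mul, Complex.norm_cpow_eq_rpow_re_of_pos h0,
    Complex.norm_cpow_eq_rpow_re_of_pos h1,
    Complex.ofReal_cpow h0.le, Complex.ofReal_cpow h1.le]
  simp

/-- The Gauss summation formula for a hypergeometric series at `1`. -/
lemma Complex.hasSum_Gamma_mul_Gamma_div {w μ : ℂ} (h0 : 0 < w.re) (h1 : w.re < 1 / 2)
    (hμ : μ.re = 0) :
    HasSum (fun n : ℕ => Complex.Gamma (w + n) * Complex.Gamma (w + μ + n) /
      (n.factorial * Complex.Gamma (μ + n + 1)))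
      (Complex.Gamma w * Complex.Gamma (w + μ) * Complex.Gamma (1 - 2 * w) /
        (Complex.Gamma (1 - w) * Complex.Gamma (1 + μ - w))) := by
  have hG1 : Complex.Gamma (1 - w) ≠ 0 :=
    Complex.Gamma_ne_zero_of_re_pos (by simp; linarith)
  let F (n : ℕ) (u : ℝ) : ℂ := Complex.Gamma (w + n) / n.factorial *
    ((u:ℂ) ^ ((w + μ + n) - 1) * (1 - (u:ℂ)) ^ ((1 - w) - 1))
  have hs (n : ℕ) : 0 < (w + μ + n).re := by
    have : (0:ℝ) ≤ n := n.cast_nonneg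
    simp [hμ]; linarith
  have ht : 0 < (1 - w).re := by simp; linarith
  have hF (n : ℕ) : IntegrableOn (F n) (Ioo 0 1) :=
    (Complex.integrableOn_beta (hs n) ht).const_mul _
  have hsum : Summable fun n => ∫ u in Ioo 0 1, ‖F n u‖ := by
    refine Summable.of_nonneg_of_le (fun n => integral_nonneg fun u => norm_nonneg _) (fun n => ?_)
      ((Real.summable_Gamma_add_nat_div_factorial_sq h0 h1).mul_left (Real.Gamma (1 - w.re)))
    simp only [F, norm_mul (Complex.Gamma (w + n) / n.factorial)]
    rw [integral_const_mul, Complex.integral_norm_beta (hs n) ht, norm_div, Complex.norm_natCast]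
    have hn : 0 < (w + n).re := by simpa [hμ] using hs n
    have h := Complex.norm_Gamma_le_Gamma_re hn
    have e1 : (w + n).re = w.re + n := by simp
    have e2 : (w + μ + n).re = w.re + n := by simp [hμ]
    have e3 : (1 - w).re = 1 - w.re := by simp
    rw [e1] at h hn
    rw [e2, e3, show w.re + n + (1 - w.re) = (n:ℝ) + 1 by ring, Real.Gamma_nat_eq_factorial]
    have p1 : 0 < Real.Gamma (w.re + n) := Real.Gamma_pos_of_pos hn
    have p2 : 0 < Real.Gamma (1 - w.re) := Real.Gamma_pos_of_pos (by rwa [e3] at ht)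
    calc _ ≤ Real.Gamma (w.re + n) / n.factorial *
          (Real.Gamma (w.re + n) * Real.Gamma (1 - w.re) / n.factorial) := by gcongr
      _ = _ := by ring
  have h := (hasSum_integral_of_summable_integral_norm hF hsum).div_const (Complex.Gamma (1 - w))
  have hlim : ∫ u in Ioo (0:ℝ) 1, ∑' n, F n u = Complex.Gamma w * (Complex.Gamma (w + μ) *
      Complex.Gamma (1 - 2 * w) / Complex.Gamma (1 + μ - w)) := by
    have e := Complex.integral_beta (s := w + μ) (t := 1 - 2 * w) (by simpa [hμ])
      (by simp; linarith)
    rw [show w + μ + (1 - 2 * w) = 1 + μ - w by ring] at e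
    rw [← e, ← integral_const_mul]
    refine setIntegral_congr_fun measurableSet_Ioo fun u hu => ?_
    have p0 : 0 < u := hu.1
    have p1 : 0 < 1 - u := sub_pos.mpr hu.2
    have c0 : (u:ℂ) ≠ 0 := by exact_mod_cast p0.ne'
    have c1 : 1 - (u:ℂ) ≠ 0 := by exact_mod_cast p1.ne'
    have hb := Complex.hasSum_Gamma_add_nat_mul_pow h0 (u := (u:ℂ))
      (by rw [Complex.norm_real, Real.norm_of_nonneg p0.le]; exact hu.2)
    refine ((hb.mul_right ((u:ℂ) ^ (w + μ - 1) * (1 - (u:ℂ)) ^ (-w))).congr_fun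
      (fun n => ?_)).tsum_eq.trans ?_
    · simp only [F]
      rw [show w + μ + n - 1 = (w + μ - 1) + n by ring, Complex.cpow_add _ _ c0,
        Complex.cpow_natCast, show 1 - w - 1 = -w by ring]
      ring
    · rw [show 1 - 2 * w - 1 = -w + -w by ring, Complex.cpow_add _ _ c1]
      ring
  rw [hlim] at h
  convert! h.congr_fun fun n => ?_ using 1
  · field_simp
  · simp only [F]
    rw [integral_const_mul, Complex.integral_beta (hs n) ht,
      show w + μ + n + (1 - w) = μ + n + 1 by ring]
    field_simp

lemma ofReal_besselKi (τ : ℝ) {x : ℝ} (hx : 0 < x) :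
    ((besselKi τ x : ℝ) : ℂ) = (1 / 2) * ∫ u : ℝ,
      Complex.exp (-x * (Real.cosh u : ℂ)) * Complex.exp (2 * Complex.I * (τ / 2 : ℝ) * u) := by
  rw [← besselK_eq_integral_univ (z := x) (by simpa using hx), besselKi, besselK,
    ← integral_complex_ofReal]
  refine setIntegral_congr_fun measurableSet_Ioi fun t _ => ?_
  rw [show 2 * Complex.I * ((τ / 2 : ℝ) : ℂ) * t = (τ * t) * Complex.I by push_cast; ring,
    Complex.cosh_mul_I]
  push_cast
  rfl

lemma integrable_besselKi_prod (τ : ℝ) {z : ℂ} (hz : 0 < z.re) :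
    Integrable (fun p : ℝ × ℝ => Complex.exp (-p.1 * (Real.cosh p.2 : ℂ)) *
      Complex.exp (2 * Complex.I * τ * p.2) * (p.1 : ℂ) ^ (z - 1))
      ((volume.restrict (Ioi 0)).prod volume) := by
  have hn (u : ℝ) : EqOn (fun x : ℝ => ‖Complex.exp (-x * (Real.cosh u : ℂ)) *
      Complex.exp (2 * Complex.I * τ * u) * (x : ℂ) ^ (z - 1)‖)
      (fun x : ℝ => x ^ (z.re - 1) * Real.exp (-(Real.cosh u * x))) (Ioi 0) := fun x hx => by
    have hx : 0 < x := hx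
    simp only
    rw [norm_mul, norm_exp_neg_mul_cosh_mul_exp, Complex.norm_cpow_eq_rpow_re_of_pos hx]
    simp [mul_comm]
  have hm : Measurable (fun p : ℝ × ℝ => Complex.exp (-p.1 * (Real.cosh p.2 : ℂ)) *
      Complex.exp (2 * Complex.I * τ * p.2) * (p.1 : ℂ) ^ (z - 1)) := by fun_prop
  rw [integrable_prod_iff' hm.aestronglyMeasurable]
  refine ⟨Eventually.of_forall fun u => ?_, ?_⟩
  · refine (integrable_norm_iff (hm.comp (by fun_prop :
      Measurable fun x : ℝ => (x, u))).aestronglyMeasurable).mp ?_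
    have h := integrableOn_rpow_mul_exp_neg_mul_rpow (s := z.re - 1) (p := 1)
      (b := Real.cosh u) (by linarith) one_pos (Real.cosh_pos u)
    refine (IntegrableOn.congr_fun h (fun x hx => ?_) measurableSet_Ioi)
    refine Eq.trans ?_ (hn u hx).symm
    simp
  · refine ((integrable_cosh_rpow hz).mul_const (Real.Gamma z.re)).congr
      (Eventually.of_forall fun u => ?_)
    simp only
    rw [setIntegral_congr_fun measurableSet_Ioi (hn u),
      Real.integral_rpow_mul_exp_neg_mul_Ioi hz (Real.cosh_pos u), one_div,
      Real.inv_rpow (Real.cosh_pos u).le, Real.rpow_neg (Real.cosh_pos u).le]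

lemma besselKi_mul_cpow_eq (τ : ℝ) (z : ℂ) {x : ℝ} (hx : 0 < x) :
    ((besselKi τ x : ℝ) : ℂ) * (x : ℂ) ^ (z - 1) = (1 / 2) * ∫ u : ℝ,
      Complex.exp (-x * (Real.cosh u : ℂ)) * Complex.exp (2 * Complex.I * (τ / 2 : ℝ) * u) *
        (x : ℂ) ^ (z - 1) := by
  rw [ofReal_besselKi τ hx, integral_mul_const, mul_assoc]

lemma integrableOn_besselKi_mul_cpow (τ : ℝ) {z : ℂ} (hz : 0 < z.re) :
    IntegrableOn (fun x : ℝ => ((besselKi τ x : ℝ) : ℂ) * (x : ℂ) ^ (z - 1)) (Ioi 0) :=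
  IntegrableOn.congr_fun
    ((integrable_besselKi_prod (τ / 2) hz).integral_prod_left.const_mul (1 / 2))
    (fun _ hx => (besselKi_mul_cpow_eq τ z hx).symm) measurableSet_Ioi

lemma integral_besselKi_mul_cpow (τ : ℝ) {z : ℂ} (hz : 0 < z.re) :
    ∫ x in Ioi (0:ℝ), ((besselKi τ x : ℝ) : ℂ) * (x : ℂ) ^ (z - 1) =
      (2:ℂ) ^ (z - 2) * (Complex.Gamma ((z + Complex.I * τ) / 2) *
        Complex.Gamma ((z - Complex.I * τ) / 2)) := by
  have hz2 : 0 < (z / 2).re := by simpa using hz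
  rw [setIntegral_congr_fun measurableSet_Ioi fun _ hx => besselKi_mul_cpow_eq τ z hx,
    integral_const_mul, integral_integral_swap (integrable_besselKi_prod (τ / 2) hz)]
  have e (u : ℝ) : ∫ x in Ioi (0:ℝ), Complex.exp (-x * (Real.cosh u : ℂ)) *
      Complex.exp (2 * Complex.I * (τ / 2 : ℝ) * u) * (x : ℂ) ^ (z - 1) =
      Complex.Gamma z * (Complex.exp (2 * Complex.I * (τ / 2 : ℝ) * u) *
        ((Real.cosh u : ℝ) : ℂ) ^ (-(2 * (z / 2)))) := by
    have h := Complex.integral_cpow_mul_exp_neg_mul_Ioi (a := z) (r := Real.cosh u) hz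
      (Real.cosh_pos u)
    have h1 : (1 / (Real.cosh u : ℂ)) ^ z = (Real.cosh u : ℂ) ^ (-(2 * (z / 2))) := by
      rw [one_div, Complex.inv_cpow _ _ (by
        rw [Complex.arg_ofReal_of_nonneg (Real.cosh_pos u).le]; exact Real.pi_pos.ne),
        ← Complex.cpow_neg]
      ring_nf
    rw [h1] at h
    rw [mul_comm (Complex.exp _), ← mul_assoc, mul_comm (Complex.Gamma z), ← h,
      ← integral_mul_const]
    congr 1 with x
    rw [show -(x:ℂ) * (Real.cosh u : ℂ) = -((Real.cosh u : ℂ) * x) by ring]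
    ring
  simp only [e]
  rw [integral_const_mul]
  change 1 / 2 * (Complex.Gamma z * coshTransform (τ / 2) (z / 2)) = _
  have n := Complex.Gamma_ne_zero_of_re_pos hz
  rw [coshTransform_eq _ hz2, mul_div_cancel₀ z two_ne_zero, show z - 2 = z - 1 - 1 by ring,
    Complex.cpow_sub (z - 1) 1 two_ne_zero, Complex.cpow_one]
  rw [show z / 2 + Complex.I * (τ / 2 : ℝ) = (z + Complex.I * τ) / 2 by push_cast; ring,
    show z / 2 - Complex.I * (τ / 2 : ℝ) = (z - Complex.I * τ) / 2 by push_cast; ring]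
  field_simp

lemma norm_besselKi_le (τ : ℝ) {x : ℝ} (hx : 0 < x) : ‖besselKi τ x‖ ≤ besselKi 0 x := by
  refine norm_integral_le_of_norm_le ?_ (Eventually.of_forall fun t => ?_)
  · simpa [IntegrableOn] using (integrable_exp_neg_cosh hx).integrableOn (s := Ioi 0)
  · rw [zero_mul, Real.cos_zero, mul_one, norm_mul, Real.norm_of_nonneg (Real.exp_pos _).le]
    exact mul_le_of_le_one_right (Real.exp_pos _).le (Real.abs_cos_le_one _)

lemma integral_norm_besselKi_mul_cpow_le (τ : ℝ) {z : ℂ} (hz : 0 < z.re) :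
    ∫ x in Ioi (0:ℝ), ‖((besselKi τ x : ℝ) : ℂ) * (x : ℂ) ^ (z - 1)‖ ≤
      2 ^ (z.re - 2) * Real.Gamma (z.re / 2) ^ 2 := by
  have hσ : 0 < ((z.re : ℝ) : ℂ).re := by simpa using hz
  have e (x : ℝ) (hx : x ∈ Ioi (0:ℝ)) : ((besselKi 0 x : ℝ) : ℂ) * (x : ℂ) ^ ((z.re : ℂ) - 1) =
      ((besselKi 0 x * x ^ (z.re - 1) : ℝ) : ℂ) := by
    rw [Complex.ofReal_mul, Complex.ofReal_cpow (le_of_lt hx)]; push_cast; rfl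
  have hi := (integrableOn_besselKi_mul_cpow 0 hσ).congr_fun e measurableSet_Ioi
  have h := integral_besselKi_mul_cpow 0 hσ
  rw [setIntegral_congr_fun measurableSet_Ioi e, integral_complex_ofReal] at h
  have h2 : ((2 ^ (z.re - 2) * Real.Gamma (z.re / 2) ^ 2 : ℝ) : ℂ) =
      (2:ℂ) ^ ((z.re : ℂ) - 2) * (Complex.Gamma (((z.re : ℂ) + Complex.I * (0:ℝ)) / 2) *
        Complex.Gamma (((z.re : ℂ) - Complex.I * (0:ℝ)) / 2)) := by
    rw [Complex.ofReal_mul, Complex.ofReal_cpow (by norm_num), Complex.ofReal_pow,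
      ← Complex.Gamma_ofReal]
    push_cast
    simp [sq]
  rw [← h2] at h
  rw [← Complex.ofReal_injective h]
  refine setIntegral_mono_on (integrableOn_besselKi_mul_cpow τ hz).norm hi.re
    measurableSet_Ioi fun x hx => ?_
  have hx : 0 < x := hx
  rw [norm_mul, Complex.norm_real, Complex.norm_cpow_eq_rpow_re_of_pos hx]
  simpa using mul_le_mul_of_nonneg_right (norm_besselKi_le τ hx) (by positivity)

lemma Complex.ofReal_div_two_cpow {x : ℝ} (hx : 0 < x) (s : ℂ) :
    ((x:ℂ) / 2) ^ s = (x:ℂ) ^ s * (2:ℂ) ^ (-s) := by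
  have h := Complex.mul_cpow_ofReal_nonneg (a := x / 2) (b := 2) (by positivity) (by norm_num) s
  push_cast at h
  have h2 : (2:ℂ) ^ s ≠ 0 := by simp [Complex.cpow_eq_zero_iff]
  rw [div_mul_cancel₀ _ two_ne_zero] at h
  rw [h, Complex.cpow_neg]
  field_simp

/-- The `n`-th term of the power series of `K_{iτ}(x) I_{iτ}(x) x ^ (2 * w - 1)`. -/
noncomputable def besselProductTerm (τ : ℝ) (w : ℂ) (n : ℕ) (x : ℝ) : ℂ :=
  (2:ℂ) ^ (-(Complex.I * τ + 2 * n)) /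
      ((n.factorial : ℂ) * Complex.Gamma (Complex.I * τ + (n:ℂ) + 1)) *
    (((besselKi τ x : ℝ) : ℂ) * (x:ℂ) ^ ((2 * w + Complex.I * τ + 2 * n) - 1))

lemma tsum_besselProductTerm (τ : ℝ) (w : ℂ) {x : ℝ} (hx : 0 < x) :
    ∑' n, besselProductTerm τ w n x =
      ((besselKi τ x : ℝ) : ℂ) * besselI (Complex.I * τ) x * (x:ℂ) ^ (2 * w - 1) := by
  have hx' : (x:ℂ) ≠ 0 := by exact_mod_cast hx.ne'
  rw [besselI, ← tsum_mul_left, ← tsum_mul_right]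
  congr 1 with n
  rw [Complex.ofReal_div_two_cpow hx, besselProductTerm,
    show 2 * w + Complex.I * τ + 2 * n - 1 = (Complex.I * τ + 2 * n) + (2 * w - 1) by ring,
    Complex.cpow_add _ _ hx']
  ring

lemma besselProduct_exponent_re {w : ℂ} (h0 : 0 < w.re) (τ : ℝ) (n : ℕ) :
    0 < (2 * w + Complex.I * τ + 2 * n).re := by
  simp; positivity

lemma integrableOn_besselProductTerm (τ : ℝ) {w : ℂ} (h0 : 0 < w.re) (n : ℕ) :
    IntegrableOn (besselProductTerm τ w n) (Ioi 0) :=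
  (integrableOn_besselKi_mul_cpow τ (besselProduct_exponent_re h0 τ n)).const_mul _

lemma integral_besselProductTerm (τ : ℝ) {w : ℂ} (h0 : 0 < w.re) (n : ℕ) :
    ∫ x in Ioi (0:ℝ), besselProductTerm τ w n x = (2:ℂ) ^ (2 * w - 2) *
      (Complex.Gamma (w + n) * Complex.Gamma (w + Complex.I * τ + n) /
        (n.factorial * Complex.Gamma (Complex.I * τ + n + 1))) := by
  simp only [besselProductTerm]
  rw [integral_const_mul, integral_besselKi_mul_cpow τ (besselProduct_exponent_re h0 τ n),
    show (2 * w + Complex.I * τ + 2 * n + Complex.I * τ) / 2 = w + Complex.I * τ + n by ring,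
    show (2 * w + Complex.I * τ + 2 * n - Complex.I * τ) / 2 = w + n by ring,
    show 2 * w + Complex.I * τ + 2 * n - 2 = (2 * w - 2) + (Complex.I * τ + 2 * n) by ring,
    Complex.cpow_add _ _ two_ne_zero, Complex.cpow_neg]
  have h2 : (2:ℂ) ^ (Complex.I * τ + 2 * n) ≠ 0 := by simp [Complex.cpow_eq_zero_iff]
  field_simp

lemma integral_norm_besselProductTerm_le (τ : ℝ) {w : ℂ} (h0 : 0 < w.re) (n : ℕ) :
    ∫ x in Ioi (0:ℝ), ‖besselProductTerm τ w n x‖ ≤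
      2 ^ (2 * w.re - 2) / ‖Complex.Gamma (Complex.I * τ + 1)‖ *
        (Real.Gamma (w.re + n) / n.factorial) ^ 2 := by
  have hz := besselProduct_exponent_re h0 τ n
  have h := integral_norm_besselKi_mul_cpow_le τ hz
  have hre : (2 * w + Complex.I * τ + 2 * n).re = 2 * w.re + 2 * n := by simp
  rw [hre, show (2 * w.re + 2 * n) / 2 = w.re + n by ring] at h
  have hf : (0:ℝ) < n.factorial := by exact_mod_cast n.factorial_pos
  have hG : 0 < ‖Complex.Gamma (Complex.I * τ + 1)‖ :=
    norm_pos_iff.mpr (Complex.Gamma_ne_zero_of_re_pos (by simp))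
  have hG' := Complex.factorial_mul_norm_Gamma_le (μ := Complex.I * τ) (by simp) n
  have h2 : ‖(2:ℂ) ^ (-(Complex.I * τ + 2 * n))‖ = (2 ^ (2 * n : ℝ))⁻¹ := by
    have := Complex.norm_cpow_eq_rpow_re_of_pos (x := 2) (by norm_num) (-(Complex.I * τ + 2 * n))
    rw [Complex.ofReal_ofNat] at this
    rw [this, ← Real.rpow_neg (by norm_num)]
    simp
  simp only [besselProductTerm, norm_mul, norm_div] at h ⊢
  rw [integral_const_mul, h2, Complex.norm_natCast]
  have hp : (2:ℝ) ^ (2 * w.re + 2 * n - 2) = 2 ^ (2 * w.re - 2) * 2 ^ (2 * n : ℝ) := by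
    rw [← Real.rpow_add (by norm_num)]; ring_nf
  rw [hp] at h
  have hpos : (0:ℝ) < 2 ^ (2 * n : ℝ) := by positivity
  calc _ ≤ (2 ^ (2 * n : ℝ))⁻¹ /
        (n.factorial * (n.factorial * ‖Complex.Gamma (Complex.I * τ + 1)‖)) *
        (2 ^ (2 * w.re - 2) * 2 ^ (2 * n : ℝ) * Real.Gamma (w.re + n) ^ 2) := by
        gcongr
    _ = _ := by field_simp

lemma summable_integral_norm_besselProductTerm (τ : ℝ) {w : ℂ} (h0 : 0 < w.re)
    (h1 : w.re < 1 / 2) :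
    Summable fun n => ∫ x in Ioi (0:ℝ), ‖besselProductTerm τ w n x‖ :=
  .of_nonneg_of_le (fun _ => integral_nonneg fun _ => norm_nonneg _)
    (integral_norm_besselProductTerm_le τ h0)
    ((Real.summable_Gamma_add_nat_div_factorial_sq h0 h1).mul_left _)

lemma integrableOn_besselKi_mul_besselI (τ : ℝ) {w : ℂ} (h0 : 0 < w.re) (h1 : w.re < 1 / 2) :
    IntegrableOn (fun x : ℝ =>
      ((besselKi τ x : ℝ) : ℂ) * besselI (Complex.I * τ) x * (x:ℂ) ^ (2 * w - 1)) (Ioi 0) :=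
  IntegrableOn.congr_fun (integrable_tsum_of_summable_integral_norm
    (integrableOn_besselProductTerm τ h0) (summable_integral_norm_besselProductTerm τ h0 h1))
    (fun _ hx => tsum_besselProductTerm τ w hx) measurableSet_Ioi

lemma integral_besselKi_mul_besselI (τ : ℝ) {w : ℂ} (h0 : 0 < w.re) (h1 : w.re < 1 / 2) :
    ∫ x in Ioi (0:ℝ),
      ((besselKi τ x : ℝ) : ℂ) * besselI (Complex.I * τ) x * (x:ℂ) ^ (2 * w - 1) =
      1 / (4 * (Real.sqrt Real.pi : ℝ)) * (Complex.Gamma w * Complex.Gamma (1 / 2 - w) *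
        (Complex.Gamma (w + Complex.I * τ) / Complex.Gamma (1 + Complex.I * τ - w))) := by
  have h := hasSum_integral_of_summable_integral_norm (integrableOn_besselProductTerm τ h0)
    (summable_integral_norm_besselProductTerm τ h0 h1)
  rw [setIntegral_congr_fun measurableSet_Ioi fun _ hx => tsum_besselProductTerm τ w hx] at h
  simp only [integral_besselProductTerm τ h0] at h
  rw [h.unique ((Complex.hasSum_Gamma_mul_Gamma_div h0 h1
    (μ := Complex.I * τ) (by simp)).mul_left _)]
  have hd := Complex.Gamma_mul_Gamma_add_half (1 / 2 - w)
  rw [show 1 / 2 - w + 1 / 2 = 1 - w by ring, show 2 * (1 / 2 - w) = 1 - 2 * w by ring,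
    sub_sub_cancel] at hd
  have n1 : Complex.Gamma (1 - w) ≠ 0 :=
    Complex.Gamma_ne_zero_of_re_pos (by simp; linarith)
  have n2 : Complex.Gamma (1 + Complex.I * τ - w) ≠ 0 :=
    Complex.Gamma_ne_zero_of_re_pos (by simp; linarith)
  have np : ((Real.sqrt Real.pi : ℝ) : ℂ) ≠ 0 := by
    exact_mod_cast (Real.sqrt_pos.mpr Real.pi_pos).ne'
  have e : (2:ℂ) ^ (2 * w - 2) = (2:ℂ) ^ (2 * w) / 4 := by
    rw [Complex.cpow_sub _ _ two_ne_zero]; norm_num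
  rw [e, eq_comm]
  generalize Complex.Gamma (1 / 2 - w) = G at *
  generalize Complex.Gamma (1 - 2 * w) = G' at *
  generalize (2:ℂ) ^ (2 * w) = z at *
  field_simp
  linear_combination Complex.Gamma w * Complex.Gamma (w + Complex.I * τ) * hd

lemma Complex.inv_Gamma_one_sub {z : ℂ} (hz : 0 < z.re) (hz' : z.re < 1) :
    (Complex.Gamma (1 - z))⁻¹ = Complex.Gamma z * Complex.sin (Real.pi * z) / Real.pi := by
  have h := Complex.Gamma_mul_Gamma_one_sub z
  have n1 := Complex.Gamma_ne_zero_of_re_pos hz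
  have n2 : Complex.Gamma (1 - z) ≠ 0 := Complex.Gamma_ne_zero_of_re_pos (by simpa using hz')
  have np : (Real.pi : ℂ) ≠ 0 := by exact_mod_cast Real.pi_ne_zero
  have ns : Complex.sin (Real.pi * z) ≠ 0 := fun hs => by
    rw [hs, div_zero] at h
    exact mul_ne_zero n1 n2 h
  rw [eq_div_iff ns] at h
  generalize Complex.sin (Real.pi * z) = S at *
  field_simp
  linear_combination -h

lemma Gamma_div_Gamma_add_Gamma_div_Gamma (τ : ℝ) {w : ℂ} (h0 : 0 < w.re) (h1 : w.re < 1) :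
    Complex.Gamma (w + Complex.I * τ) / Complex.Gamma (1 + Complex.I * τ - w) +
      Complex.Gamma (w - Complex.I * τ) / Complex.Gamma (1 - Complex.I * τ - w) =
    2 * (Real.cosh (Real.pi * τ) : ℂ) * (Complex.sin (Real.pi * w) / Real.pi) *
      (Complex.Gamma (w + Complex.I * τ) * Complex.Gamma (w - Complex.I * τ)) := by
  have e1 := Complex.inv_Gamma_one_sub (z := w - Complex.I * τ) (by simpa) (by simpa)
  have e2 := Complex.inv_Gamma_one_sub (z := w + Complex.I * τ) (by simpa) (by simpa)
  rw [show 1 - (w - Complex.I * τ) = 1 + Complex.I * τ - w by ring] at e1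
  rw [show 1 - (w + Complex.I * τ) = 1 - Complex.I * τ - w by ring] at e2
  rw [div_eq_mul_inv, div_eq_mul_inv, e1, e2, mul_sub, mul_add, Complex.sin_sub, Complex.sin_add,
    show (Real.pi : ℂ) * (Complex.I * τ) = (Real.pi * τ) * Complex.I by ring, Complex.cos_mul_I]
  push_cast
  ring

lemma besselKi_neg (τ x : ℝ) : besselKi (-τ) x = besselKi τ x := by
  simp [besselKi]

lemma besselKi_mul_besselI_add_eq (τ : ℝ) (w : ℂ) (x : ℝ) :
    ((besselKi τ x : ℝ) : ℂ) *
        (besselI (Complex.I * τ) x + besselI (-(Complex.I * τ)) x) * (x:ℂ) ^ (2 * w - 1) =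
      ((besselKi τ x : ℝ) : ℂ) * besselI (Complex.I * τ) x * (x:ℂ) ^ (2 * w - 1) +
      ((besselKi (-τ) x : ℝ) : ℂ) * besselI (Complex.I * (-τ : ℝ)) x * (x:ℂ) ^ (2 * w - 1) := by
  rw [besselKi_neg, Complex.ofReal_neg, mul_neg]
  ring

lemma integrableOn_besselKi_mul_besselI_add (τ : ℝ) {w : ℂ} (h0 : 0 < w.re) (h1 : w.re < 1 / 2) :
    IntegrableOn (fun x : ℝ => ((besselKi τ x : ℝ) : ℂ) *
      (besselI (Complex.I * τ) x + besselI (-(Complex.I * τ)) x) * (x:ℂ) ^ (2 * w - 1))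
      (Ioi 0) := by
  simp only [besselKi_mul_besselI_add_eq]
  exact (integrableOn_besselKi_mul_besselI τ h0 h1).add
    (integrableOn_besselKi_mul_besselI (-τ) h0 h1)

lemma integral_besselKi_mul_besselI_add (τ : ℝ) {w : ℂ} (h0 : 0 < w.re) (h1 : w.re < 1 / 2) :
    ∫ x in Ioi (0:ℝ), ((besselKi τ x : ℝ) : ℂ) *
      (besselI (Complex.I * τ) x + besselI (-(Complex.I * τ)) x) * (x:ℂ) ^ (2 * w - 1) =
      (Real.cosh (Real.pi * τ) : ℂ) / (2 * (Real.sqrt Real.pi : ℝ)) *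
        (Complex.Gamma (1 / 2 - w) / Complex.Gamma (1 - w) *
          (Complex.Gamma (w + Complex.I * τ) * Complex.Gamma (w - Complex.I * τ))) := by
  simp only [besselKi_mul_besselI_add_eq]
  rw [integral_add (integrableOn_besselKi_mul_besselI τ h0 h1)
    (integrableOn_besselKi_mul_besselI (-τ) h0 h1), integral_besselKi_mul_besselI τ h0 h1,
    integral_besselKi_mul_besselI (-τ) h0 h1, Complex.ofReal_neg, mul_neg, ← sub_eq_add_neg,
    ← sub_eq_add_neg, ← mul_add, ← mul_add,
    Gamma_div_Gamma_add_Gamma_div_Gamma τ h0 (by linarith),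
    div_eq_mul_inv _ (Complex.Gamma (1 - w)),
    Complex.inv_Gamma_one_sub h0 (by linarith)]
  ring

lemma gammaWeight_mul_integral_besselKi (τ : ℝ) {w : ℂ} (h0 : 0 < w.re) (h1 : w.re < 1 / 2) :
    gammaWeight (1 - w) * ∫ x in Ioi (0:ℝ), ((besselKi τ x : ℝ) : ℂ) *
      (besselI (Complex.I * τ) x + besselI (-(Complex.I * τ)) x) * (x:ℂ) ^ (2 * w - 1) =
      4 * (Real.cosh (Real.pi * τ) : ℂ) * kernelMellin τ w := by
  rw [integral_besselKi_mul_besselI_add τ h0 h1, kernelMellin_eq τ h0, gammaWeight,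
    show 1 - (1 - w) = w by ring, show 3 / 2 - (1 - w) = w + 1 / 2 by ring,
    show 1 - w - 1 / 2 = 1 / 2 - w by ring]
  have n1 : Complex.Gamma (1 / 2 - w) ≠ 0 :=
    Complex.Gamma_ne_zero_of_re_pos (by simp; linarith)
  have n2 : Complex.Gamma (1 - w) ≠ 0 :=
    Complex.Gamma_ne_zero_of_re_pos (by simp; linarith)
  generalize Complex.Gamma (1 / 2 - w) = G at *
  generalize Complex.Gamma (w + 1 / 2) = G' at *
  field_simp
  ring

lemma Complex.ofReal_sq_cpow_mul_self {x : ℝ} (hx : 0 < x) (w : ℂ) :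
    ((x ^ 2 : ℝ) : ℂ) ^ (-(1 - w)) * x = (x:ℂ) ^ (2 * w - 1) := by
  have hx' : (x:ℂ) ≠ 0 := by exact_mod_cast hx.ne'
  have h := Complex.ofReal_rpow_cpow hx 2 (-(1 - w))
  rw [Real.rpow_two] at h
  rw [h, show 2 * w - 1 = 2 * -(1 - w) + 1 by ring, Complex.cpow_add _ _ hx', Complex.cpow_one]
  push_cast
  rfl

lemma integral_besselKi_mul_phiFn {f : ℝ → ℝ} {ν a b : ℝ} (hν : 0 < ν) (hν' : ν ≤ 3 / 4)
    (hf : LocallyIntegrableOn f (Ioi 0)) (ha : a < ν) (hb : 3 / 4 < b)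
    (hO0 : f =O[nhdsWithin 0 (Ioi 0)] fun x => x ^ (-a))
    (hOinf : f =O[atTop] fun x => x ^ (-b)) (τ : ℝ) :
    ∫ x in Ioi (0:ℝ), ((besselKi τ x : ℝ) : ℂ) *
        (besselI (Complex.I * τ) x + besselI (-(Complex.I * τ)) x) * phiFn f ν (x ^ 2) * (x:ℂ) =
      4 * (Real.cosh (Real.pi * τ) : ℂ) * ((1 / (2 * (Real.pi:ℂ))) *
        ∫ t : ℝ, kernelMellin τ (quarterLine t) * mellinT f (1 - quarterLine t)) := by
  have hh := integrable_gammaWeight_mul_mellinT (σ := 3 / 4) hf (by linarith) (by norm_num) hb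
    (by norm_num) hO0 hOinf
  simp only [← one_sub_quarterLine] at hh
  have hg : IntegrableOn (fun x : ℝ => ((x ^ (-(1 / 2) : ℝ) : ℝ) : ℂ) * (((besselKi τ x : ℝ) : ℂ) *
      (besselI (Complex.I * τ) x + besselI (-(Complex.I * τ)) x))) (Ioi 0) := by
    refine (integrableOn_besselKi_mul_besselI_add τ (w := 1 / 4) (by norm_num)
      (by norm_num)).congr_fun (fun x hx => ?_) measurableSet_Ioi
    have hx : 0 < x := hx
    simp only
    rw [Complex.ofReal_cpow hx.le, mul_comm]
    congr 2
    push_cast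
    norm_num
  have h := integral_mul_integral_cpow_swap (w := fun t => 2 * quarterLine t - 1)
    ((continuous_quarterLine.const_mul 2).sub continuous_const)
    (fun t => by simp; norm_num) hh hg
  have e (t : ℝ) : gammaWeight (1 - quarterLine t) * mellinT f (1 - quarterLine t) *
      ∫ x in Ioi (0:ℝ), ((besselKi τ x : ℝ) : ℂ) *
        (besselI (Complex.I * τ) x + besselI (-(Complex.I * τ)) x) *
          (x:ℂ) ^ (2 * quarterLine t - 1) =
      4 * (Real.cosh (Real.pi * τ) : ℂ) *
        (kernelMellin τ (quarterLine t) * mellinT f (1 - quarterLine t)) := by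
    rw [mul_right_comm, gammaWeight_mul_integral_besselKi τ (by simp) (by simp; norm_num)]
    ring
  simp only [e] at h
  rw [integral_const_mul] at h
  rw [mul_left_comm, ← h, ← integral_const_mul]
  refine setIntegral_congr_fun measurableSet_Ioi fun x hx => ?_
  have hx : 0 < x := hx
  rw [phiFn_eq_integral_quarterLine hf ha hν hν' hb hO0 hOinf (sq_pos_of_pos hx), mul_assoc,
    mul_right_comm _ (∫ t : ℝ, _) (x:ℂ)]
  rw [mul_assoc (1 / (2 * (Real.pi:ℂ))), mul_comm (x:ℂ), ← integral_mul_const, mul_left_comm]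
  simp only [mul_assoc, Complex.ofReal_sq_cpow_mul_self hx]
/-- Representation (2.7) of the index transform. -/
theorem indexF_via_phi (ν a b : ℝ) (hν1 : 0 < ν) (hν2 : ν < 1/2)
    (f : ℝ → ℝ) (hf : MeasureTheory.LocallyIntegrableOn f (Set.Ioi 0))
    (ha : a < ν) (hb1 : 5/4 < b) (hb2 : b < 3/2)
    (hO0 : f =O[nhdsWithin 0 (Set.Ioi 0)] fun x => x ^ (-a))
    (hOinf : f =O[atTop] fun x => x ^ (-b))
    (hm1 : mellinT f 1 = 0) (hm2 : deriv (mellinT f) 1 = 0) :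
    ∀ τ : ℝ, 0 ≤ τ →
      ((indexF f τ : ℝ) : ℂ) = ((1/(4*Real.cosh (Real.pi*τ)) : ℝ) : ℂ) *
        ∫ x in Set.Ioi (0:ℝ), ((besselKi τ x : ℝ) : ℂ) *
          (besselI (Complex.I*(τ:ℂ)) (x:ℂ) + besselI (-(Complex.I*(τ:ℂ))) (x:ℂ)) *
          phiFn f ν (x^2) * (x:ℂ) := by
  intro τ _
  have hc : (Real.cosh (Real.pi * τ) : ℂ) ≠ 0 := by exact_mod_cast (Real.cosh_pos _).ne'
  rw [integral_besselKi_mul_phiFn hν1 (by linarith) hf ha (by linarith) hO0 hOinf,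
    indexF_eq_integral_mellinT hf (by linarith) (by linarith) hO0 hOinf]
  rw [Complex.ofReal_div, Complex.ofReal_mul]
  push_cast at hc ⊢
  field_simp
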